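/- There exist a nonempty open set U ⊂ ℝ⁴, constants C > 0 and μ₀ > 0, all independent of μ, such that for every μ ∈ (0, μ₀) and every point z ∈ U there exist a point y with |y − z| ≤ C·μ^{1/20}, times 0 < T′ < T with T > 1, and a solution γ : [0,T] → ℝ⁴ of the restricted planar circular three-body problem with γ(0) = y, such that |γ(T) − z| ≤ C·μ^{1/20} and the position component x(T′) of γ(T′) satisfies |x(T′) − (1−μ,0)| ≤ C·μ^{1/20}. That is, every point of U is O(μ^{1/20})-non-wandering, and its orbit neighborhood passes O(μ^{1/20})-close to collision before returning. -/

import Mathlib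

/-- Euclidean norm of a planar vector given by its two components. -/
noncomputable def norm2 (a b : ℝ) : ℝ := Real.sqrt (a ^ 2 + b ^ 2)

/-- Euclidean distance between two points of `ℝ⁴ = ℝ × ℝ × ℝ × ℝ`. -/
noncomputable def dist4 (P Q : ℝ × ℝ × ℝ × ℝ) : ℝ :=
  Real.sqrt ((P.1 - Q.1) ^ 2 + (P.2.1 - Q.2.1) ^ 2 +
    (P.2.2.1 - Q.2.2.1) ^ 2 + (P.2.2.2 - Q.2.2.2) ^ 2)

/-- `(x1, x2, y1, y2)` is a solution of the restricted planar circular three body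
problem with mass parameter `μ` on the set of times `s`, i.e. it solves
`ẋ = ∂H_μ/∂y`, `ẏ = -∂H_μ/∂x` for the Hamiltonian
`H_μ(x,y) = |y|²/2 − xᵗJy − μ/|x−(1−μ,0)| − (1−μ)/|x−(−μ,0)|`. -/
def IsRCP3BPSol (μ : ℝ) (s : Set ℝ) (x1 x2 y1 y2 : ℝ → ℝ) : Prop :=
  ∀ t ∈ s,
    HasDerivAt x1 (y1 t + x2 t) t ∧
    HasDerivAt x2 (y2 t - x1 t) t ∧
    HasDerivAt y1 (y2 t
      - μ * (x1 t - (1 - μ)) / (norm2 (x1 t - (1 - μ)) (x2 t)) ^ 3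
      - (1 - μ) * (x1 t + μ) / (norm2 (x1 t + μ) (x2 t)) ^ 3) t ∧
    HasDerivAt y2 (- y1 t
      - μ * x2 t / (norm2 (x1 t - (1 - μ)) (x2 t)) ^ 3
      - (1 - μ) * x2 t / (norm2 (x1 t + μ) (x2 t)) ^ 3) t

namespace RC

open Real Set Metric

/-- Truncated inverse-square field `x / max(|x|,c)^3`. -/
noncomputable def nc (c : ℝ) (x : ℂ) : ℂ := ((1 / (max ‖x‖ c) ^ 3 : ℝ) : ℂ) * x

/-- Truncation to the ball of radius 20. -/
noncomputable def cl (x : ℂ) : ℂ := ((20 / max ‖x‖ 20 : ℝ) : ℂ) * x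

lemma nc_eq {c : ℝ} {x : ℂ} (h : c ≤ ‖x‖) : nc c x = ((1 / ‖x‖ ^ 3 : ℝ) : ℂ) * x := by
  rw [nc, max_eq_left h]

lemma cl_eq {x : ℂ} (h : ‖x‖ ≤ 20) : cl x = x := by
  rw [cl, max_eq_right h]; norm_num

lemma nc_norm_le {c : ℝ} (hc : 0 < c) (x : ℂ) : ‖nc c x‖ ≤ 1 / c ^ 2 := by
  have h1 : c ≤ max ‖x‖ c := le_max_right _ _
  have h2 : ‖x‖ ≤ max ‖x‖ c := le_max_left _ _
  rw [nc, norm_mul, Complex.norm_real, Real.norm_eq_abs]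
  set A := max ‖x‖ c
  have hA : 0 < A := lt_of_lt_of_le hc h1
  rw [abs_of_pos (by positivity)]
  calc 1 / A ^ 3 * ‖x‖ ≤ 1 / A ^ 3 * A := by gcongr
    _ = 1 / A ^ 2 := by field_simp
    _ ≤ 1 / c ^ 2 := by gcongr

lemma cl_norm_le (x : ℂ) : ‖cl x‖ ≤ 20 := by
  have h2 : ‖x‖ ≤ max ‖x‖ 20 := le_max_left _ _
  have h1 : 20 ≤ max ‖x‖ 20 := le_max_right _ _
  rw [cl, norm_mul, Complex.norm_real, Real.norm_eq_abs]
  set A := max ‖x‖ 20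
  have hA : 0 < A := by linarith
  rw [abs_of_pos (by positivity)]
  calc 20 / A * ‖x‖ ≤ 20 / A * A := by gcongr
    _ = 20 := by field_simp

lemma abs_max_sub_le (x y : ℂ) (c : ℝ) : |max ‖x‖ c - max ‖y‖ c| ≤ ‖x - y‖ :=
  (abs_max_sub_max_le_abs _ _ _).trans (abs_norm_sub_norm_le x y)

lemma nc_lip {c : ℝ} (hc : 0 < c) (x y : ℂ) : ‖nc c x - nc c y‖ ≤ 4 / c ^ 3 * ‖x - y‖ := by
  have hA1 : c ≤ max ‖x‖ c := le_max_right _ _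
  have hB1 : c ≤ max ‖y‖ c := le_max_right _ _
  have hB2 : ‖y‖ ≤ max ‖y‖ c := le_max_left _ _
  have hAB := abs_max_sub_le x y c
  rw [nc, nc]
  set A := max ‖x‖ c
  set B := max ‖y‖ c
  have hA : 0 < A := lt_of_lt_of_le hc hA1
  have hB : 0 < B := lt_of_lt_of_le hc hB1
  have e1 : ((1 / A ^ 3 : ℝ) : ℂ) * x - ((1 / B ^ 3 : ℝ) : ℂ) * y
      = ((1 / A ^ 3 : ℝ) : ℂ) * (x - y) + ((1 / A ^ 3 - 1 / B ^ 3 : ℝ) : ℂ) * y := by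
    push_cast; ring
  rw [e1]
  refine (norm_add_le _ _).trans ?_
  rw [norm_mul, norm_mul, Complex.norm_real, Complex.norm_real, Real.norm_eq_abs,
    Real.norm_eq_abs, abs_of_pos (by positivity : 0 < 1 / A ^ 3)]
  have e2 : 1 / A ^ 3 - 1 / B ^ 3
      = (B - A) * ((1 / (A ^ 3 * B) + 1 / (A ^ 2 * B ^ 2) + 1 / (A * B ^ 3))) := by
    field_simp; ring
  have e3 : |1 / A ^ 3 - 1 / B ^ 3| * ‖y‖ ≤ 3 / c ^ 3 * ‖x - y‖ := by
    rw [e2, abs_mul, abs_sub_comm,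
      abs_of_pos (by positivity : 0 < 1 / (A ^ 3 * B) + 1 / (A ^ 2 * B ^ 2) + 1 / (A * B ^ 3))]
    calc |A - B| * (1 / (A ^ 3 * B) + 1 / (A ^ 2 * B ^ 2) + 1 / (A * B ^ 3)) * ‖y‖
        ≤ ‖x - y‖ * (1 / (A ^ 3 * B) + 1 / (A ^ 2 * B ^ 2) + 1 / (A * B ^ 3)) * B := by gcongr
      _ = ‖x - y‖ * (1 / (A * A * A) + 1 / (A * A * B) + 1 / (A * B * B)) := by
          field_simp
      _ ≤ ‖x - y‖ * (1 / (c * c * c) + 1 / (c * c * c) + 1 / (c * c * c)) := by gcongr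
      _ = 3 / c ^ 3 * ‖x - y‖ := by field_simp; ring
  have e4 : 1 / A ^ 3 * ‖x - y‖ ≤ 1 / c ^ 3 * ‖x - y‖ := by gcongr
  calc _ ≤ 1 / c ^ 3 * ‖x - y‖ + 3 / c ^ 3 * ‖x - y‖ := add_le_add e4 e3
    _ = _ := by ring

lemma cl_lip (x y : ℂ) : ‖cl x - cl y‖ ≤ 2 * ‖x - y‖ := by
  have hA1 : 20 ≤ max ‖x‖ 20 := le_max_right _ _
  have hB1 : 20 ≤ max ‖y‖ 20 := le_max_right _ _
  have hB2 : ‖y‖ ≤ max ‖y‖ 20 := le_max_left _ _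
  have hAB := abs_max_sub_le x y 20
  rw [cl, cl]
  set A := max ‖x‖ 20
  set B := max ‖y‖ 20
  have hA : 0 < A := by linarith
  have hB : 0 < B := by linarith
  have e1 : ((20 / A : ℝ) : ℂ) * x - ((20 / B : ℝ) : ℂ) * y
      = ((20 / A : ℝ) : ℂ) * (x - y) + ((20 / A - 20 / B : ℝ) : ℂ) * y := by
    push_cast; ring
  rw [e1]
  refine (norm_add_le _ _).trans ?_
  rw [norm_mul, norm_mul, Complex.norm_real, Complex.norm_real, Real.norm_eq_abs,
    Real.norm_eq_abs, abs_of_pos (by positivity : 0 < 20 / A)]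
  have e2 : 20 / A - 20 / B = (B - A) * (20 / (A * B)) := by field_simp
  have h20 : 20 / A ≤ 1 := by rw [div_le_one hA]; exact hA1
  have e3 : |20 / A - 20 / B| * ‖y‖ ≤ ‖x - y‖ := by
    rw [e2, abs_mul, abs_sub_comm, abs_of_pos (by positivity : 0 < 20 / (A * B))]
    calc |A - B| * (20 / (A * B)) * ‖y‖ ≤ ‖x - y‖ * (20 / (A * B)) * B := by gcongr
      _ = ‖x - y‖ * (20 / A) := by field_simp
      _ ≤ ‖x - y‖ * 1 := by gcongr
      _ = _ := by ring
  have e4 : 20 / A * ‖x - y‖ ≤ 1 * ‖x - y‖ := by gcongr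
  linarith

/-- Truncated Kepler field. -/
noncomputable def FK (z : ℂ × ℂ) : ℂ × ℂ := (cl z.2, - nc (1 / 4) z.1)

lemma FK_lip : LipschitzWith 256 FK := by
  apply LipschitzWith.of_dist_le_mul
  intro z w
  rw [dist_eq_norm, dist_eq_norm, FK, FK]
  have h1 : ‖z.1 - w.1‖ ≤ ‖z - w‖ := norm_fst_le (z - w)
  have h2 : ‖z.2 - w.2‖ ≤ ‖z - w‖ := norm_snd_le (z - w)
  have h3 := cl_lip z.2 w.2
  have h4 := nc_lip (by norm_num : (0:ℝ) < 1 / 4) z.1 w.1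
  have h5 := norm_nonneg (z - w)
  rw [Prod.mk_sub_mk, Prod.norm_mk]
  refine max_le ?_ ?_
  · push_cast; linarith
  · rw [← neg_sub', norm_neg]; push_cast; norm_num at h4 ⊢; linarith

lemma FK_norm_le (z : ℂ × ℂ) : ‖FK z‖ ≤ 20 := by
  rw [FK, Prod.norm_mk]
  refine max_le (cl_norm_le _) ?_
  rw [norm_neg]
  refine (nc_norm_le (by norm_num) _).trans (by norm_num)

lemma gron {E : Type*} [NormedAddCommGroup E] [NormedSpace ℝ E] {F : E → E} {L : NNReal}
    (hL1 : 1 ≤ L) (hL : LipschitzWith L F) {f f' g : ℝ → E} {ε δ : ℝ} (hε : 0 ≤ ε) (hδ : 0 ≤ δ)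
    (hf : ∀ t ∈ Icc (0:ℝ) 10, HasDerivAt f (f' t) t)
    (hfe : ∀ t ∈ Icc (0:ℝ) 10, ‖f' t - F (f t)‖ ≤ ε)
    (hg : ∀ t, HasDerivAt g (F (g t)) t)
    (h0 : ‖f 0 - g 0‖ ≤ δ) :
    ∀ t ∈ Icc (0:ℝ) 10, ‖f t - g t‖ ≤ (δ + ε) * exp (L * 10) := by
  intro t ht
  have hL1' : (1:ℝ) ≤ L := by exact_mod_cast hL1
  have key := dist_le_of_approx_trajectories_ODE (v := fun _ => F) (K := L) (a := 0) (b := 10)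
    (f := f) (g := g) (f' := f') (g' := fun t => F (g t)) (εf := ε) (εg := 0) (δ := δ)
    (fun _ => hL) (fun s hs => (hf s hs).continuousAt.continuousWithinAt)
    (fun s hs => (hf s (Ico_subset_Icc_self hs)).hasDerivWithinAt)
    (fun s hs => by rw [dist_eq_norm]; exact hfe s (Ico_subset_Icc_self hs))
    (fun s hs => (hg s).continuousAt.continuousWithinAt)
    (fun s hs => (hg s).hasDerivWithinAt)
    (fun s hs => by simp) (by rw [dist_eq_norm]; exact h0) t ht
  rw [dist_eq_norm, gronwallBound_of_K_ne_0 (by linarith), add_zero, sub_zero] at key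
  have e1 : exp (L * t) ≤ exp (L * 10) := by
    apply exp_le_exp.2; have := ht.2; gcongr
  have e2 : (1:ℝ) ≤ exp (L * t) := one_le_exp (by have := ht.1; positivity)
  have e3 : ε / L ≤ ε := div_le_self hε hL1'
  have e4 : 0 ≤ ε / L := by positivity
  calc _ ≤ _ := key
    _ ≤ δ * exp (L * 10) + ε * exp (L * 10) := by
      have : ε / L * (exp (L * t) - 1) ≤ ε * exp (L * 10) := by
        apply mul_le_mul e3 _ (by linarith) hε
        linarith
      have : δ * exp (L * t) ≤ δ * exp (L * 10) := by gcongr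
      linarith
    _ = _ := by ring

lemma shadow {E : Type*} [NormedAddCommGroup E] [NormedSpace ℝ E] {F : E → E} {L : NNReal}
    (hL1 : 1 ≤ L) (hL : LipschitzWith L F) {M : ℝ} (hM : ∀ x, ‖F x‖ ≤ M)
    {y : E} {ρ A : ℝ} (hρ : 0 ≤ ρ) (hA : 0 ≤ A) {τ : E → ℝ} {K : E → ℝ → E}
    (hK0 : ∀ ζ ∈ closedBall y ρ, K ζ 0 = ζ)
    (hK : ∀ ζ ∈ closedBall y ρ, ∀ t, HasDerivAt (K ζ) (F (K ζ t)) t)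
    (hper : ∀ ζ ∈ closedBall y ρ, K ζ (τ ζ) = ζ)
    (hτ : ∀ ζ ∈ closedBall y ρ, 1 ≤ τ ζ ∧ τ ζ ≤ 10)
    (hτL : ∀ ζ ∈ closedBall y ρ, |τ ζ - τ y| ≤ A * ‖ζ - y‖)
    (hpery : ∀ t, K y (t + τ y) = K y t)
    (N : ℕ) {ε : ℝ} (hε : 0 ≤ ε) {z z' : ℝ → E}
    (hz : ∀ t ∈ Icc (0:ℝ) (10 * (N + 2)), HasDerivAt z (z' t) t)
    (hze : ∀ t ∈ Icc (0:ℝ) (10 * (N + 2)), ‖z' t - F (z t)‖ ≤ ε)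
    (hz0 : z 0 = y)
    (hs1 : exp (L * 10) * ε * (N + 1) ≤ ρ)
    (hs2 : A * exp (L * 10) * ε * (N + 1) ^ 2 ≤ 1) :
    ∀ t ∈ Icc (0:ℝ) (N * τ y), ‖z t - K y t‖ ≤
      (exp (L * 10) + exp (L * 10) ^ 2 + M * A * exp (L * 10)) * (N + 1) ^ 2 * ε := by
  have hyb : y ∈ closedBall y ρ := mem_closedBall_self hρ
  set C1 := exp (L * 10) with hC1
  have hC1p : 0 < C1 := exp_pos _
  have hM0 : 0 ≤ M := (norm_nonneg _).trans (hM y)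
  have hpern : ∀ (n : ℕ) t, K y (t + n * τ y) = K y t := by
    intro n
    induction n with
    | zero => intro t; simp
    | succ n ih =>
      intro t
      have : t + ((n + 1 : ℕ) : ℝ) * τ y = (t + n * τ y) + τ y := by push_cast; ring
      rw [this, hpery, ih]
  have hspeed : ∀ s t, ‖K y s - K y t‖ ≤ M * |s - t| := by
    intro s t
    have := convex_univ.norm_image_sub_le_of_norm_hasDerivWithin_le (f := K y)
      (f' := fun t => F (K y t)) (C := M) (fun x _ => (hK y hyb x).hasDerivWithinAt)
      (fun x _ => hM _) (mem_univ t) (mem_univ s)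
    rwa [Real.norm_eq_abs] at this
  have main : ∀ n : ℕ, n ≤ N + 1 → ∃ tn : ℝ, 0 ≤ tn ∧ tn ≤ 10 * n ∧
      |tn - n * τ y| ≤ n ^ 2 * (A * C1 * ε) ∧ ‖z tn - y‖ ≤ n * (C1 * ε) ∧
      ∀ t ∈ Icc (0:ℝ) tn, ‖z t - K y t‖ ≤ (C1 + C1 ^ 2 + M * A * C1) * (N + 1) ^ 2 * ε := by
    intro n
    induction n with
    | zero =>
      intro _
      refine ⟨0, le_rfl, by simp, by simp, by simp [hz0], ?_⟩
      intro t ht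
      have : t = 0 := le_antisymm ht.2 ht.1
      rw [this, hz0, hK0 y hyb, sub_self, norm_zero]
      positivity
    | succ n ih =>
      intro hn
      obtain ⟨tn, h0, h10, hclose, hzn, hall⟩ := ih (by omega)
      have hnN : (n : ℝ) ≤ N := by exact_mod_cast (by omega : n ≤ N)
      have hn0 : (0:ℝ) ≤ n := Nat.cast_nonneg n
      have hZ : z tn ∈ closedBall y ρ := by
        rw [mem_closedBall, dist_eq_norm]
        refine hzn.trans (le_trans ?_ hs1)
        have : 0 ≤ C1 * ε := by positivity
        nlinarith
      have hdom : ∀ s ∈ Icc (0:ℝ) 10, s + tn ∈ Icc (0:ℝ) (10 * (N + 2)) := by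
        intro s hs
        exact ⟨by linarith [hs.1], by linarith [hs.2]⟩
      have g1 : ∀ s ∈ Icc (0:ℝ) 10, ‖z (s + tn) - K (z tn) s‖ ≤ (0 + ε) * C1 := by
        apply gron hL1 hL (f := fun s => z (s + tn)) (f' := fun s => z' (s + tn)) hε le_rfl
        · intro s hs
          exact (hz _ (hdom s hs)).comp_add_const s tn
        · intro s hs; exact hze _ (hdom s hs)
        · exact hK _ hZ
        · simp [hK0 _ hZ]
      have g2 : ∀ s ∈ Icc (0:ℝ) 10, ‖K (z tn) s - K y s‖ ≤ (n * (C1 * ε) + 0) * C1 := by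
        apply gron hL1 hL (f := K (z tn)) (f' := fun s => F (K (z tn) s)) le_rfl (by positivity)
        · intro s hs
          exact hK _ hZ s
        · intro s hs; simp
        · exact hK _ hyb
        · rw [hK0 _ hZ, hK0 _ hyb]; exact hzn
      obtain ⟨hτ1, hτ10⟩ := hτ _ hZ
      have hτd := hτL _ hZ
      have hτd' : |τ (z tn) - τ y| ≤ A * (n * (C1 * ε)) := hτd.trans (by gcongr)
      refine ⟨tn + τ (z tn), by linarith, by push_cast; linarith, ?_, ?_, ?_⟩
      · have e : tn + τ (z tn) - ((n + 1 : ℕ) : ℝ) * τ y = (tn - n * τ y) + (τ (z tn) - τ y) := by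
          push_cast; ring
        rw [e]
        refine (abs_add_le _ _).trans ((add_le_add hclose hτd').trans ?_)
        have : 0 ≤ A * C1 * ε := by positivity
        push_cast; nlinarith
      · have g := g1 (τ (z tn)) ⟨by linarith, hτ10⟩
        rw [hper _ hZ, add_comm] at g
        calc ‖z (tn + τ (z tn)) - y‖
            = ‖(z (tn + τ (z tn)) - z tn) + (z tn - y)‖ := by congr 1; abel
          _ ≤ _ := (norm_add_le _ _).trans (add_le_add g hzn)
          _ = _ := by push_cast; ring
      · intro t ht
        by_cases htn : t ≤ tn
        · exact hall t ⟨ht.1, htn⟩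
        · push Not at htn
          set s := t - tn with hs
          have hsI : s ∈ Icc (0:ℝ) 10 := ⟨by linarith, by linarith [ht.2]⟩
          have ets : t = s + tn := by rw [hs]; ring
          have a1 := g1 s hsI
          have a2 := g2 s hsI
          have a3 := hspeed (s + n * τ y) (s + tn)
          rw [hpern n s, show s + n * τ y - (s + tn) = -(tn - n * τ y) by ring, abs_neg] at a3
          have a3' : ‖K y s - K y (s + tn)‖ ≤ M * (n ^ 2 * (A * C1 * ε)) :=
            a3.trans (by gcongr)
          rw [ets]
          calc ‖z (s + tn) - K y (s + tn)‖
              = ‖(z (s + tn) - K (z tn) s) + (K (z tn) s - K y s) + (K y s - K y (s + tn))‖ := by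
                congr 1; abel
            _ ≤ (0 + ε) * C1 + (n * (C1 * ε) + 0) * C1 + M * (n ^ 2 * (A * C1 * ε)) :=
                (norm_add₃_le).trans (add_le_add (add_le_add a1 a2) a3')
            _ = 1 * (C1 * ε) + n * (C1 ^ 2 * ε) + n ^ 2 * (M * A * C1 * ε) := by ring
            _ ≤ (N + 1) ^ 2 * (C1 * ε) + (N + 1) ^ 2 * (C1 ^ 2 * ε)
                  + (N + 1) ^ 2 * (M * A * C1 * ε) := by
                have b1 : (1:ℝ) ≤ (N + 1) ^ 2 := by nlinarith
                have b2 : (n:ℝ) ≤ (N + 1) ^ 2 := by nlinarith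
                have b3 : (n:ℝ) ^ 2 ≤ (N + 1) ^ 2 := by nlinarith
                gcongr
            _ = _ := by ring
  obtain ⟨tn, h0, h10, hclose, hzn, hall⟩ := main (N + 1) le_rfl
  intro t ht
  apply hall t ⟨ht.1, ht.2.trans ?_⟩
  have h1 := (hτ y hyb).1
  have h2 := (abs_le.1 hclose).1
  push_cast at h2
  nlinarith

end RC

namespace RC

open Real Set Metric

structure Good (b r s : ℝ) : Prop where
  hb : |b - 1| ≤ 1 / 50
  hr : |r - 1 / 2| ≤ 1 / 100
  hs : |s| ≤ 1 / 100

noncomputable def rE (b r s E : ℝ) : ℝ := b ^ 2 + (r - b ^ 2) * cos E + b * s * sin E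
noncomputable def tE (b r s E : ℝ) : ℝ :=
  b * (b ^ 2 * E + (r - b ^ 2) * sin E + b * s * (1 - cos E))
noncomputable def fE (b r E : ℝ) : ℝ := 1 - b ^ 2 / r * (1 - cos E)
noncomputable def gE (b r s E : ℝ) : ℝ := b * r * sin E + b ^ 2 * s * (1 - cos E)
noncomputable def fd (b r s E : ℝ) : ℝ := - (b * sin E / (rE b r s E * r))
noncomputable def gd (b r s E : ℝ) : ℝ := 1 - b ^ 2 / rE b r s E * (1 - cos E)

section
variable {b r s : ℝ}

lemma Good.b_lo (h : Good b r s) : 49 / 50 ≤ b := by have := abs_le.1 h.hb; linarith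
lemma Good.b_hi (h : Good b r s) : b ≤ 51 / 50 := by have := abs_le.1 h.hb; linarith
lemma Good.r_lo (h : Good b r s) : 49 / 100 ≤ r := by have := abs_le.1 h.hr; linarith
lemma Good.r_hi (h : Good b r s) : r ≤ 51 / 100 := by have := abs_le.1 h.hr; linarith

lemma Good.bs (h : Good b r s) : |b * s| ≤ 1 / 90 := by
  rw [abs_mul, abs_of_pos (by linarith [h.b_lo] : 0 < b)]
  have := h.hs; have := h.b_hi; have := h.b_lo; have := abs_nonneg s
  nlinarith

lemma Good.bsq (h : Good b r s) : 24 / 25 ≤ b ^ 2 ∧ b ^ 2 ≤ 261 / 250 := by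
  have := h.b_hi; have := h.b_lo
  constructor <;> nlinarith

lemma Good.X (h : Good b r s) : 9 / 20 ≤ b ^ 2 - r ∧ b ^ 2 - r ≤ 277 / 500 := by
  have := h.bsq; have := h.r_lo; have := h.r_hi
  constructor <;> linarith

lemma Good.rE_sub (h : Good b r s) (E : ℝ) : |rE b r s E - b ^ 2| ≤ 283 / 500 := by
  have e : rE b r s E - b ^ 2 = (r - b ^ 2) * cos E + b * s * sin E := by rw [rE]; ring
  rw [e]
  refine (abs_add_le _ _).trans ?_
  rw [abs_mul, abs_mul (b * s)]
  have h1 := abs_cos_le_one E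
  have h2 := abs_sin_le_one E
  have h3 := h.bs
  have h4 : |r - b ^ 2| ≤ 277 / 500 := by
    rw [abs_sub_comm, abs_of_pos (by linarith [h.X.1])]; exact h.X.2
  have : |r - b ^ 2| * |cos E| ≤ 277 / 500 * 1 := by gcongr
  have : |b * s| * |sin E| ≤ 1 / 90 * 1 := by gcongr
  linarith

lemma Good.rE_lo (h : Good b r s) (E : ℝ) : 39 / 100 ≤ rE b r s E := by
  have := abs_le.1 (h.rE_sub E); have := h.bsq; linarith

lemma Good.rE_hi (h : Good b r s) (E : ℝ) : rE b r s E ≤ 2 := by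
  have := abs_le.1 (h.rE_sub E); have := h.bsq; linarith

lemma tE_deriv (E : ℝ) : HasDerivAt (tE b r s) (b * rE b r s E) E := by
  have h := (((hasDerivAt_id E).const_mul (b ^ 2)).add
    ((hasDerivAt_sin E).const_mul (r - b ^ 2))).add
    (((hasDerivAt_cos E).const_sub 1).const_mul (b * s)) |>.const_mul b
  refine h.congr_deriv ?_
  rw [rE]; ring

lemma rE_deriv (E : ℝ) : HasDerivAt (rE b r s) (-(r - b ^ 2) * sin E + b * s * cos E) E := by
  have h := (((hasDerivAt_cos E).const_mul (r - b ^ 2)).const_add (b ^ 2)).add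
    ((hasDerivAt_sin E).const_mul (b * s))
  refine h.congr_deriv ?_
  ring

lemma tE_add (E : ℝ) : tE b r s (E + 2 * π) = tE b r s E + 2 * π * b ^ 3 := by
  rw [tE, tE, sin_add_two_pi, cos_add_two_pi]; ring

lemma tE_zero : tE b r s 0 = 0 := by simp [tE]

lemma Good.tE_mono (h : Good b r s) : StrictMono (tE b r s) := by
  apply strictMono_of_deriv_pos
  intro E
  rw [(tE_deriv E).deriv]
  have := h.rE_lo E; have := h.b_lo
  positivity

lemma Good.tE_surj (h : Good b r s) : Function.Surjective (tE b r s) := by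
  have hc : Continuous (tE b r s) := continuous_iff_continuousAt.2 fun E => (tE_deriv E).continuousAt
  have hbd : ∀ E, |tE b r s E - b ^ 3 * E| ≤ 2 := by
    intro E
    have e : tE b r s E - b ^ 3 * E = b * ((r - b ^ 2) * sin E + b * s * (1 - cos E)) := by
      rw [tE]; ring
    have h1 := abs_sin_le_one E
    have h2 : |1 - cos E| ≤ 2 := by
      rw [abs_le]; constructor <;> linarith [neg_one_le_cos E, cos_le_one E]
    have h4 : |r - b ^ 2| ≤ 277 / 500 := by
      rw [abs_sub_comm, abs_of_pos (by linarith [h.X.1])]; exact h.X.2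
    have h5 : |(r - b ^ 2) * sin E + b * s * (1 - cos E)| ≤ 1 := by
      refine (abs_add_le _ _).trans ?_
      rw [abs_mul, abs_mul (b * s)]
      have : |r - b ^ 2| * |sin E| ≤ 277 / 500 * 1 := by gcongr
      have : |b * s| * |1 - cos E| ≤ 1 / 90 * 2 := mul_le_mul h.bs h2 (abs_nonneg _) (by norm_num)
      linarith
    rw [e, abs_mul, abs_of_pos (by linarith [h.b_lo] : 0 < b)]
    have := h.b_hi; have := h.b_lo
    nlinarith
  have hb3 : 0 < b ^ 3 := by have := h.b_lo; positivity
  apply hc.surjective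
  · have h0 : Filter.Tendsto (fun E : ℝ => b ^ 3 * E - 2) Filter.atTop Filter.atTop :=
      Filter.tendsto_atTop_add_const_right _ _ (Filter.tendsto_id.const_mul_atTop hb3)
    refine Filter.tendsto_atTop_mono (fun E => ?_) h0
    have := abs_le.1 (hbd E); linarith
  · have h0 : Filter.Tendsto (fun E : ℝ => b ^ 3 * E + 2) Filter.atBot Filter.atBot :=
      Filter.tendsto_atBot_add_const_right _ _ (Filter.tendsto_id.const_mul_atBot hb3)
    refine Filter.tendsto_atBot_mono (fun E => ?_) h0
    have := abs_le.1 (hbd E); linarith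

lemma Good.exists_inv (h : Good b r s) : ∃ e : ℝ → ℝ, (∀ t, tE b r s (e t) = t) ∧
    (∀ E, e (tE b r s E) = E) ∧ (∀ t, HasDerivAt e (b * rE b r s (e t))⁻¹ t) ∧
    ∀ t, e (t + 2 * π * b ^ 3) = e t + 2 * π := by
  set o := h.tE_mono.orderIsoOfSurjective _ h.tE_surj with ho
  have h1 : ∀ t, tE b r s (o.symm t) = t := fun t => o.apply_symm_apply t
  have h2 : ∀ E, o.symm (tE b r s E) = E := fun E => o.symm_apply_apply E
  refine ⟨o.symm, h1, h2, ?_, ?_⟩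
  · intro t
    apply HasDerivAt.of_local_left_inverse (f := tE b r s)
    · exact o.symm.continuous.continuousAt
    · exact tE_deriv _
    · have := h.rE_lo (o.symm t); have := h.b_lo
      positivity
    · exact Filter.Eventually.of_forall h1
  · intro t
    apply h.tE_mono.injective
    rw [h1, tE_add, h1]

/-- eccentric anomaly as function of time -/
noncomputable def ecc (b r s : ℝ) : ℝ → ℝ := by
  classical
  exact if h : Good b r s then Classical.choose h.exists_inv else fun _ => 0

lemma ecc_spec (h : Good b r s) : (∀ t, tE b r s (ecc b r s t) = t) ∧
    (∀ E, ecc b r s (tE b r s E) = E) ∧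
    (∀ t, HasDerivAt (ecc b r s) (b * rE b r s (ecc b r s t))⁻¹ t) ∧
    ∀ t, ecc b r s (t + 2 * π * b ^ 3) = ecc b r s t + 2 * π := by
  have := Classical.choose_spec h.exists_inv
  rw [ecc, dif_pos h]
  exact this

lemma fE_deriv (E : ℝ) (h : Good b r s) :
    HasDerivAt (fE b r) (b * rE b r s E * fd b r s E) E := by
  have h1 := ((((hasDerivAt_cos E).const_sub 1).const_mul (b ^ 2 / r)).const_sub 1)
  refine h1.congr_deriv ?_
  have := h.rE_lo E
  have : rE b r s E ≠ 0 := by linarith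
  have : r ≠ 0 := by linarith [h.r_lo]
  rw [fd]; field_simp

lemma gE_deriv (E : ℝ) (h : Good b r s) :
    HasDerivAt (gE b r s) (b * rE b r s E * gd b r s E) E := by
  have h1 := ((hasDerivAt_sin E).const_mul (b * r)).add
    (((hasDerivAt_cos E).const_sub 1).const_mul (b ^ 2 * s))
  refine h1.congr_deriv ?_
  have := h.rE_lo E
  have h0 : rE b r s E ≠ 0 := by linarith
  have : r ≠ 0 := by linarith [h.r_lo]
  rw [gd]; field_simp; rw [rE]; ring

lemma fd_deriv (E : ℝ) (h : Good b r s) :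
    HasDerivAt (fd b r s) (b * rE b r s E * (-(fE b r E / rE b r s E ^ 3))) E := by
  have := h.rE_lo E
  have h0 : rE b r s E ≠ 0 := by linarith
  have hr : r ≠ 0 := by linarith [h.r_lo]
  have h1 := (((hasDerivAt_sin E).const_mul b).div ((rE_deriv (b := b) (r := r) (s := s) E).mul_const r)
    (mul_ne_zero h0 hr)).neg
  refine h1.congr_deriv ?_
  rw [fE]; field_simp
  have h2 := sin_sq_add_cos_sq E
  rw [rE]
  linear_combination (-b * (r - b ^ 2)) * h2

lemma gd_deriv (E : ℝ) (h : Good b r s) :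
    HasDerivAt (gd b r s) (b * rE b r s E * (-(gE b r s E / rE b r s E ^ 3))) E := by
  have := h.rE_lo E
  have h0 : rE b r s E ≠ 0 := by linarith
  have hr : r ≠ 0 := by linarith [h.r_lo]
  have h1 := ((((hasDerivAt_const E (b ^ 2)).div (rE_deriv (b := b) (r := r) (s := s) E) h0)).mul
    ((hasDerivAt_cos E).const_sub 1)).const_sub 1
  refine h1.congr_deriv ?_
  simp only [Pi.div_apply]
  rw [gE]; field_simp
  have h2 := sin_sq_add_cos_sq E
  rw [rE]
  linear_combination (-b ^ 3 * s) * h2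

end

/-- Kepler orbit with parameter `b` (square root of the semimajor axis). -/
noncomputable def rr (z : ℂ × ℂ) : ℝ := ‖z.1‖
noncomputable def ss (z : ℂ × ℂ) : ℝ := z.1.re * z.2.re + z.1.im * z.2.im
noncomputable def vv (z : ℂ × ℂ) : ℝ := ‖z.2‖ ^ 2
noncomputable def bb (z : ℂ × ℂ) : ℝ := 1 / √(2 / rr z - vv z)

noncomputable def qE (z : ℂ × ℂ) (E : ℝ) : ℂ :=
  (fE (bb z) (rr z) E : ℂ) * z.1 + (gE (bb z) (rr z) (ss z) E : ℂ) * z.2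
noncomputable def vE (z : ℂ × ℂ) (E : ℝ) : ℂ :=
  (fd (bb z) (rr z) (ss z) E : ℂ) * z.1 + (gd (bb z) (rr z) (ss z) E : ℂ) * z.2

noncomputable def eK (z : ℂ × ℂ) (t : ℝ) : ℝ := ecc (bb z) (rr z) (ss z) t
noncomputable def KK (z : ℂ × ℂ) (t : ℝ) : ℂ × ℂ := (qE z (eK z t), vE z (eK z t))

structure GoodZ (z : ℂ × ℂ) : Prop where
  g : Good (bb z) (rr z) (ss z)
  e : 1 / bb z ^ 2 = 2 / rr z - vv z
  v : ‖z.2‖ ≤ 2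

lemma qE_norm {z : ℂ × ℂ} (h : GoodZ z) (E : ℝ) :
    ‖qE z E‖ = rE (bb z) (rr z) (ss z) E := by
  have h0 := h.g.rE_lo E
  have hr := h.g.r_lo
  have hb := h.g.b_lo
  have hsq : ‖qE z E‖ ^ 2 = rE (bb z) (rr z) (ss z) E ^ 2 := by
    have e1 : ‖qE z E‖ ^ 2 = fE (bb z) (rr z) E ^ 2 * rr z ^ 2
        + 2 * fE (bb z) (rr z) E * gE (bb z) (rr z) (ss z) E * ss z
        + gE (bb z) (rr z) (ss z) E ^ 2 * vv z := by
      rw [qE]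
      generalize fE (bb z) (rr z) E = f
      generalize gE (bb z) (rr z) (ss z) E = g
      rw [rr, vv, ss, Complex.sq_norm, Complex.sq_norm, Complex.sq_norm]
      simp only [Complex.normSq_apply, Complex.add_re, Complex.add_im, Complex.mul_re,
        Complex.mul_im, Complex.ofReal_re, Complex.ofReal_im]
      ring
    have e2 : vv z = 2 / rr z - 1 / bb z ^ 2 := by rw [h.e]; ring
    rw [e1, e2, fE, gE, rE]
    have hc := sin_sq_add_cos_sq E
    generalize bb z = b at *
    generalize rr z = r at *
    generalize ss z = s at *
    have : r ≠ 0 := by linarith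
    have : b ≠ 0 := by linarith
    generalize sin E = S at *
    generalize cos E = C at *
    rw [← sub_eq_zero]
    trans (2 * b ^ 2 * r - r ^ 2 - b ^ 2 * s ^ 2) * (S ^ 2 + C ^ 2 - 1)
    · field_simp; ring
    · rw [hc]; ring
  exact (pow_left_inj₀ (norm_nonneg _) (by linarith) (by norm_num)).1 hsq

lemma KK_zero {z : ℂ × ℂ} (h : GoodZ z) : KK z 0 = z := by
  have he : eK z 0 = 0 := by
    have := (ecc_spec h.g).2.1 0
    rwa [tE_zero] at this
  have hr := h.g.r_lo
  have : rr z ≠ 0 := by linarith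
  rw [KK, he, qE, vE]
  simp [fE, gE, fd, gd]

lemma KK_per {z : ℂ × ℂ} (h : GoodZ z) (t : ℝ) : KK z (t + 2 * π * bb z ^ 3) = KK z t := by
  have he : eK z (t + 2 * π * bb z ^ 3) = eK z t + 2 * π := (ecc_spec h.g).2.2.2 t
  rw [KK, KK, he, qE, vE, qE, vE]
  simp only [fE, gE, fd, gd, rE, cos_add_two_pi, sin_add_two_pi]

lemma vE_norm_le {z : ℂ × ℂ} (h : GoodZ z) (E : ℝ) : ‖vE z E‖ ≤ 19 := by
  have h0 := h.g.rE_lo E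
  have hr := h.g.r_lo
  have hb := h.g.b_lo
  have hb' := h.g.b_hi
  have hv := h.v
  have h1 : ‖(fd (bb z) (rr z) (ss z) E : ℂ) * z.1‖ ≤ 5 := by
    rw [norm_mul, Complex.norm_real, Real.norm_eq_abs, fd, abs_neg, abs_div, abs_mul, abs_mul,
      abs_of_pos (by linarith : 0 < bb z), abs_of_pos (by linarith : 0 < rr z),
      abs_of_pos (by linarith : 0 < rE (bb z) (rr z) (ss z) E)]
    change _ * rr z ≤ 5
    have : rr z ≠ 0 := by linarith
    have h2 := abs_sin_le_one E
    have e : bb z * |sin E| / (rE (bb z) (rr z) (ss z) E * rr z) * rr z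
      = bb z * |sin E| / rE (bb z) (rr z) (ss z) E := by field_simp
    rw [e, div_le_iff₀ (by linarith)]
    nlinarith [abs_nonneg (sin E)]
  have h2 : ‖(gd (bb z) (rr z) (ss z) E : ℂ) * z.2‖ ≤ 14 := by
    rw [norm_mul, Complex.norm_real, Real.norm_eq_abs]
    have : |gd (bb z) (rr z) (ss z) E| ≤ 7 := by
      rw [gd]
      have hc : 0 ≤ 1 - cos E := by linarith [cos_le_one E]
      have hc' : 1 - cos E ≤ 2 := by linarith [neg_one_le_cos E]
      have hd : bb z ^ 2 / rE (bb z) (rr z) (ss z) E ≤ 3 := by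
        rw [div_le_iff₀ (by linarith)]; have := h.g.bsq; linarith
      have hd' : 0 ≤ bb z ^ 2 / rE (bb z) (rr z) (ss z) E := by positivity
      rw [abs_le]; constructor <;> nlinarith
    have := norm_nonneg z.2
    nlinarith
  rw [vE]
  exact (norm_add_le _ _).trans (by linarith)

lemma KK_deriv {z : ℂ × ℂ} (h : GoodZ z) (t : ℝ) : HasDerivAt (KK z) (FK (KK z t)) t := by
  have he : HasDerivAt (eK z) (bb z * rE (bb z) (rr z) (ss z) (eK z t))⁻¹ t :=
    (ecc_spec h.g).2.2.1 t
  have hn := qE_norm h (eK z t)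
  have hv := vE_norm_le h (eK z t)
  have hlo := h.g.rE_lo (eK z t)
  have hb := h.g.b_lo
  have hne : bb z * rE (bb z) (rr z) (ss z) (eK z t) ≠ 0 := by positivity
  have dq : HasDerivAt (fun t => qE z (eK z t)) (vE z (eK z t)) t := by
    have h1 := ((((fE_deriv (eK z t) h.g).comp t he).ofReal_comp).mul_const z.1).add
      ((((gE_deriv (eK z t) h.g).comp t he).ofReal_comp).mul_const z.2)
    refine h1.congr_deriv ?_
    rw [mul_comm _ (fd _ _ _ _), mul_comm _ (gd _ _ _ _), mul_inv_cancel_right₀ hne,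
      mul_inv_cancel_right₀ hne, vE]
  have dv : HasDerivAt (fun t => vE z (eK z t)) (- nc (1 / 4) (qE z (eK z t))) t := by
    have h1 := ((((fd_deriv (eK z t) h.g).comp t he).ofReal_comp).mul_const z.1).add
      ((((gd_deriv (eK z t) h.g).comp t he).ofReal_comp).mul_const z.2)
    refine h1.congr_deriv ?_
    rw [mul_comm _ (-(fE _ _ _ / _)), mul_comm _ (-(gE _ _ _ _ / _)), mul_inv_cancel_right₀ hne,
      mul_inv_cancel_right₀ hne, nc_eq (by rw [hn]; linarith), hn, qE]
    push_cast
    ring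
  have := dq.prodMk dv
  rw [FK, KK, cl_eq (hv.trans (by norm_num))]
  exact this

end RC

namespace RC

open Real Set Metric

structure Near (k : ℝ) (z : ℂ × ℂ) : Prop where
  r : |rr z - 1 / 2| ≤ k
  s : |ss z| ≤ k
  v : |vv z - 3| ≤ k

lemma Near.ww {z : ℂ × ℂ} (h : Near (1 / 500) z) : |2 / rr z - vv z - 1| ≤ 1 / 50 := by
  have h1 := abs_le.1 h.r
  have h3 := abs_le.1 h.v
  have hr : 0 < rr z := by linarith
  have e1 : 2 / rr z ≤ 4 + 17 / 1000 := by rw [div_le_iff₀ hr]; linarith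
  have e2 : 4 - 17 / 1000 ≤ 2 / rr z := by rw [le_div_iff₀ hr]; linarith
  rw [abs_le]; constructor <;> linarith

lemma inv_sqrt_near {w : ℝ} (h : |w - 1| ≤ 1 / 50) : |1 / √w - 1| ≤ 1 / 50 ∧
    1 / (1 / √w) ^ 2 = w := by
  have h1 := abs_le.1 h
  have e1 : √w ≤ 50 / 49 := by
    rw [Real.sqrt_le_left (by norm_num)]; linarith
  have e2 : 50 / 51 ≤ √w := by
    apply Real.le_sqrt_of_sq_le; linarith
  have hp : 0 < √w := by linarith
  refine ⟨?_, ?_⟩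
  · rw [abs_le]
    constructor
    · have : 49 / 50 ≤ 1 / √w := by rw [le_div_iff₀ hp]; linarith
      linarith
    · have : 1 / √w ≤ 51 / 50 := by rw [div_le_iff₀ hp]; linarith
      linarith
  · rw [div_pow, one_pow, one_div_one_div, Real.sq_sqrt (by linarith)]

lemma Near.good {z : ℂ × ℂ} (h : Near (1 / 500) z) : GoodZ z := by
  obtain ⟨e1, e2⟩ := inv_sqrt_near h.ww
  refine ⟨⟨e1, h.r.trans (by norm_num), h.s.trans (by norm_num)⟩, e2, ?_⟩
  have h3 := abs_le.1 h.v
  rw [vv] at h3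
  have := norm_nonneg z.2
  nlinarith

lemma Near.mono {z : ℂ × ℂ} {k k' : ℝ} (h : Near k z) (hk : k ≤ k') : Near k' z :=
  ⟨h.r.trans hk, h.s.trans hk, h.v.trans hk⟩

lemma rr_sub (z w : ℂ × ℂ) : |rr z - rr w| ≤ ‖z - w‖ :=
  (abs_norm_sub_norm_le _ _).trans (norm_fst_le (z - w))

lemma ss_eq (z : ℂ × ℂ) : ss z = (z.1 * (starRingEnd ℂ) z.2).re := by
  simp [ss, Complex.mul_re]

lemma ss_sub (z w : ℂ × ℂ) : |ss z - ss w| ≤ (‖z.2‖ + ‖w.1‖) * ‖z - w‖ := by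
  have e : ss z - ss w
    = ((z.1 - w.1) * (starRingEnd ℂ) z.2 + w.1 * (starRingEnd ℂ) (z.2 - w.2)).re := by
    rw [ss_eq, ss_eq, ← Complex.sub_re, map_sub]; congr 1; ring
  rw [e]
  refine (Complex.abs_re_le_norm _).trans ((norm_add_le _ _).trans ?_)
  rw [norm_mul, norm_mul, RCLike.norm_conj, RCLike.norm_conj]
  have h1 : ‖z.1 - w.1‖ ≤ ‖z - w‖ := norm_fst_le (z - w)
  have h2 : ‖z.2 - w.2‖ ≤ ‖z - w‖ := norm_snd_le (z - w)
  have := norm_nonneg z.2; have := norm_nonneg w.1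
  nlinarith

lemma vv_sub (z w : ℂ × ℂ) : |vv z - vv w| ≤ (‖z.2‖ + ‖w.2‖) * ‖z - w‖ := by
  have e : vv z - vv w = (‖z.2‖ + ‖w.2‖) * (‖z.2‖ - ‖w.2‖) := by rw [vv, vv]; ring
  rw [e, abs_mul, abs_of_nonneg (by positivity)]
  gcongr
  exact (abs_norm_sub_norm_le _ _).trans (norm_snd_le (z - w))

lemma Near.ball {y z : ℂ × ℂ} (h : Near (1 / 1000) y) (hz : ‖z - y‖ ≤ 1 / 10000) :
    Near (1 / 500) z := by
  have hg := (h.mono (by norm_num : (1:ℝ) / 1000 ≤ 1 / 500)).good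
  have hy2 := hg.v
  have hy1 : ‖y.1‖ ≤ 1 := by have := hg.g.r_hi; rw [rr] at this; linarith
  have hz2 : ‖z.2‖ ≤ 3 := by
    have h2 : ‖z.2 - y.2‖ ≤ ‖z - y‖ := norm_snd_le (z - y)
    have := norm_le_norm_add_norm_sub' z.2 y.2
    linarith
  have a1 := abs_le.1 (rr_sub z y)
  have a2 := ss_sub z y
  have a3 := vv_sub z y
  have b2 : |ss z - ss y| ≤ 4 * (1 / 10000) := a2.trans (by
    apply mul_le_mul (by linarith) hz (norm_nonneg _) (by norm_num))
  have b3 : |vv z - vv y| ≤ 5 * (1 / 10000) := a3.trans (by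
    apply mul_le_mul (by linarith) hz (norm_nonneg _) (by norm_num))
  have b2 := abs_le.1 b2
  have b3 := abs_le.1 b3
  have c1 := abs_le.1 h.r
  have c2 := abs_le.1 h.s
  have c3 := abs_le.1 h.v
  refine ⟨?_, ?_, ?_⟩ <;> rw [abs_le] <;> constructor <;> linarith

/-- Kepler period. -/
noncomputable def tau (z : ℂ × ℂ) : ℝ := 2 * π * bb z ^ 3

lemma sq_inv_sub {a b : ℝ} (ha : 49 / 50 ≤ a) (ha' : a ≤ 51 / 50) (hb : 49 / 50 ≤ b)
    (hb' : b ≤ 51 / 50) : |a - b| ≤ |1 / a ^ 2 - 1 / b ^ 2| ∧ |1 / a ^ 2 - 1 / b ^ 2| ≤ 3 * |a - b|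
    ∧ |a - b| ≤ |a ^ 3 - b ^ 3| ∧ |a ^ 3 - b ^ 3| ≤ 4 * |a - b| := by
  have e : 1 / a ^ 2 - 1 / b ^ 2 = (b - a) * ((a + b) / (a ^ 2 * b ^ 2)) := by field_simp; ring
  have e' : a ^ 3 - b ^ 3 = (a - b) * (a ^ 2 + a * b + b ^ 2) := by ring
  have hab : a * b ≤ 51 / 50 * (51 / 50) := by gcongr
  have hab1 : 49 / 50 * (49 / 50) ≤ a * b := by gcongr
  have hp : 0 < a ^ 2 * b ^ 2 := by positivity
  have h2 : a ^ 2 * b ^ 2 ≤ (51 / 50 * (51 / 50)) ^ 2 := by rw [← mul_pow]; gcongr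
  have h2' : (49 / 50 * (49 / 50)) ^ 2 ≤ a ^ 2 * b ^ 2 := by rw [← mul_pow]; gcongr
  have h3 : 1 ≤ (a + b) / (a ^ 2 * b ^ 2) := by rw [le_div_iff₀ hp]; linarith
  have h4 : (a + b) / (a ^ 2 * b ^ 2) ≤ 3 := by rw [div_le_iff₀ hp]; linarith
  have h5 : 1 ≤ a ^ 2 + a * b + b ^ 2 := by nlinarith
  have h6 : a ^ 2 + a * b + b ^ 2 ≤ 4 := by nlinarith
  rw [e, e', abs_mul, abs_mul, abs_sub_comm b a, abs_of_pos (by linarith : 0 < (a + b) / (a ^ 2 * b ^ 2)),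
    abs_of_pos (by linarith : 0 < a ^ 2 + a * b + b ^ 2)]
  have := abs_nonneg (a - b)
  refine ⟨?_, ?_, ?_, ?_⟩ <;> nlinarith

lemma tau_bounds {z : ℂ × ℂ} (h : GoodZ z) : 1 ≤ tau z ∧ tau z ≤ 10 := by
  have h1 := h.g.b_lo
  have h2 := h.g.b_hi
  have p1 := Real.pi_gt_three
  have p2 := Real.pi_lt_d2
  have e1 : (49 / 50) ^ 3 ≤ bb z ^ 3 := by gcongr
  have e2 : bb z ^ 3 ≤ (51 / 50) ^ 3 := by gcongr
  rw [tau]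
  constructor
  · nlinarith
  · nlinarith

lemma tau_lip {y z : ℂ × ℂ} (hy : Near (1 / 500) y) (hz : Near (1 / 500) z) :
    |tau z - tau y| ≤ 600 * ‖z - y‖ := by
  have gy := hy.good
  have gz := hz.good
  have hnn := norm_nonneg (z - y)
  obtain ⟨k1, -, -, k4⟩ := sq_inv_sub gz.g.b_lo gz.g.b_hi gy.g.b_lo gy.g.b_hi
  rw [gz.e, gy.e] at k1
  have a1 := rr_sub z y
  have a3 := vv_sub z y
  have b3 : |vv z - vv y| ≤ 4 * ‖z - y‖ := a3.trans (by
    have := gy.v; have := gz.v; gcongr; linarith)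
  have hry := gy.g.r_lo
  have hrz := gz.g.r_lo
  have e : 2 / rr z - 2 / rr y = (rr y - rr z) * (2 / (rr z * rr y)) := by
    have : rr z ≠ 0 := by linarith
    have : rr y ≠ 0 := by linarith
    field_simp
  have b1 : |2 / rr z - 2 / rr y| ≤ 9 * ‖z - y‖ := by
    have hp : 0 < rr z * rr y := by
      have : 0 < rr z := by linarith
      have : 0 < rr y := by linarith
      positivity
    have : 2 / (rr z * rr y) ≤ 9 := by
      rw [div_le_iff₀ hp]; nlinarith
    rw [e, abs_mul, abs_sub_comm, abs_of_pos (by positivity : 0 < 2 / (rr z * rr y))]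
    have := abs_nonneg (rr z - rr y)
    have := mul_le_mul a1 ‹2 / (rr z * rr y) ≤ 9› (by positivity) hnn
    linarith
  have b4 : |2 / rr z - vv z - (2 / rr y - vv y)| ≤ 13 * ‖z - y‖ := by
    rw [show 2 / rr z - vv z - (2 / rr y - vv y) = (2 / rr z - 2 / rr y) - (vv z - vv y) by ring]
    exact (abs_sub _ _).trans (by linarith)
  have b5 : |bb z ^ 3 - bb y ^ 3| ≤ 52 * ‖z - y‖ := by linarith
  rw [tau, tau, ← mul_sub, abs_mul, abs_of_pos (by positivity)]
  have p2 := Real.pi_lt_d2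
  have p1 := Real.pi_gt_three
  have := mul_le_mul (by linarith : 2 * π ≤ 7) b5 (abs_nonneg _) (by norm_num)
  linarith

set_option maxHeartbeats 800000 in
/-- choose a nearby state with rational period -/
lemma exists_rational {z : ℂ × ℂ} (h : Near (1 / 2000) z) {N : ℕ} (hN : 100000 ≤ N) :
    ∃ (y : ℂ × ℂ) (p : ℕ), Odd p ∧ Near (1 / 1000) y ∧ bb y ^ 3 * N = p ∧ ‖y - z‖ ≤ 10 / N := by
  have gz := (h.mono (by norm_num : (1:ℝ) / 2000 ≤ 1 / 500)).good
  have hN' : (100000:ℝ) ≤ N := by exact_mod_cast hN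
  have hNp : (0:ℝ) < N := by linarith
  set m := ⌊bb z ^ 3 * N / 2⌋₊ with hm
  have hb1 := gz.g.b_lo
  have hb2 := gz.g.b_hi
  have hz1 := abs_le.1 h.r
  have hz3 := abs_le.1 h.v
  have hw : |1 / bb z ^ 2 - 1| ≤ 1 / 100 := by
    rw [gz.e]
    have hr : 0 < rr z := by linarith
    have e1 : 2 / rr z ≤ 4 + 5 / 1000 := by rw [div_le_iff₀ hr]; linarith
    have e2 : 4 - 5 / 1000 ≤ 2 / rr z := by rw [le_div_iff₀ hr]; linarith
    rw [abs_le]; constructor <;> linarith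
  have hbz : |bb z - 1| ≤ 1 / 100 := by
    have := (sq_inv_sub hb1 hb2 (by norm_num : (49:ℝ) / 50 ≤ 1) (by norm_num)).1
    rw [one_pow, div_one] at this
    exact this.trans hw
  have hbz' := abs_le.1 hbz
  have f1 : (m:ℝ) ≤ bb z ^ 3 * N / 2 := Nat.floor_le (by positivity)
  have f2 : bb z ^ 3 * N / 2 < m + 1 := Nat.lt_floor_add_one _
  set p := 2 * m + 1 with hp
  have hpc : (p:ℝ) = 2 * m + 1 := by rw [hp]; push_cast; ring
  set c : ℝ := p / N with hc
  have hcp : 0 < c := by rw [hc, hpc]; positivity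
  set b : ℝ := c ^ ((1:ℝ) / 3) with hb
  have hb3 : b ^ 3 = c := by
    rw [hb, ← Real.rpow_natCast, ← Real.rpow_mul hcp.le]; norm_num
  have hbp : 0 < b := Real.rpow_pos_of_pos hcp _
  have hcl : |c - bb z ^ 3| ≤ 1 / N := by
    have : c - bb z ^ 3 = (p - bb z ^ 3 * N) / N := by rw [hc]; field_simp
    rw [this, abs_div, abs_of_pos hNp]
    gcongr
    rw [hpc, abs_le]; constructor <;> linarith
  have hNi : (1:ℝ) / N ≤ 1 / 100000 := by gcongr
  have hcl' := abs_le.1 (hcl.trans hNi)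
  have hblo : 49 / 50 ≤ b := by
    by_contra hlt
    push Not at hlt
    have : b ^ 3 ≤ (49 / 50) ^ 3 := by gcongr
    have : (99 / 100) ^ 3 ≤ bb z ^ 3 := by gcongr; linarith
    linarith
  have hbhi : b ≤ 51 / 50 := by
    by_contra hlt
    push Not at hlt
    have : (51 / 50) ^ 3 ≤ b ^ 3 := by gcongr
    have : bb z ^ 3 ≤ (101 / 100) ^ 3 := by gcongr; linarith
    linarith
  obtain ⟨k1, k2, k3, k4⟩ := sq_inv_sub hblo hbhi hb1 hb2
  rw [hb3] at k3
  have hbd : |1 / b ^ 2 - 1 / bb z ^ 2| ≤ (3:ℝ) / (N:ℝ) := by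
    have : 3 * |b - bb z| ≤ 3 * (1 / N) := by gcongr; linarith
    calc _ ≤ _ := k2
      _ ≤ _ := this
      _ = 3 / N := by ring
  have h3N : (3:ℝ) / N ≤ 3 / 100000 := by gcongr
  have hbd' := abs_le.1 (hbd.trans h3N)
  have hV : 2 ≤ vv z := by linarith
  set l2 : ℝ := (2 / rr z - 1 / b ^ 2) / vv z with hl2
  have hl2e : l2 * vv z = 2 / rr z - 1 / b ^ 2 := by rw [hl2]; field_simp
  have hl2d : |l2 - 1| ≤ (3:ℝ) / (N:ℝ) := by
    have : (l2 - 1) * vv z = -(1 / b ^ 2 - 1 / bb z ^ 2) := by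
      rw [sub_mul, hl2e, gz.e]; ring
    have h1 : |l2 - 1| * vv z ≤ (3:ℝ) / (N:ℝ) := by
      rw [← abs_of_pos (by linarith : 0 < vv z), ← abs_mul, this, abs_neg]; exact hbd
    have h0 := abs_nonneg (l2 - 1)
    have h2 : |l2 - 1| * 1 ≤ |l2 - 1| * vv z := mul_le_mul_of_nonneg_left (by linarith) h0
    linarith
  have hl2d' := abs_le.1 (hl2d.trans h3N)
  set l := √l2 with hl
  have hll : l ^ 2 = l2 := Real.sq_sqrt (by linarith)
  have hl0 : 0 ≤ l := Real.sqrt_nonneg _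
  have hl1 : |l - 1| ≤ (3:ℝ) / (N:ℝ) := by
    have : |l - 1| * (l + 1) = |l2 - 1| := by
      rw [← hll, ← abs_of_nonneg (by linarith : 0 ≤ l + 1), ← abs_mul]
      congr 1; ring
    have h0 := abs_nonneg (l - 1)
    have h1 : |l - 1| * 1 ≤ |l - 1| * (l + 1) := mul_le_mul_of_nonneg_left (by linarith) h0
    linarith
  have hl1' := abs_le.1 (hl1.trans h3N)
  set y : ℂ × ℂ := (z.1, (l:ℂ) * z.2) with hy
  have yr : rr y = rr z := rfl
  have yv : vv y = l2 * vv z := by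
    rw [vv, vv, hy, norm_mul, mul_pow, Complex.norm_real, Real.norm_eq_abs, sq_abs, hll]
  have ys : ss y = l * ss z := by
    simp [ss, hy]; ring
  have yb : bb y = b := by
    rw [bb, yr, yv, hl2e, sub_sub_cancel, Real.sqrt_div (by norm_num), Real.sqrt_one,
      Real.sqrt_sq hbp.le, one_div_one_div]
  refine ⟨y, p, ⟨m, hp⟩, ⟨?_, ?_, ?_⟩, ?_, ?_⟩
  · rw [yr]; exact h.r.trans (by norm_num)
  · rw [ys, abs_mul, abs_of_nonneg hl0]
    have := mul_le_mul (by linarith : l ≤ 2) h.s (abs_nonneg _) (by norm_num)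
    linarith
  · have := mul_le_mul (abs_le.2 hl2d') (abs_le.2 ⟨by linarith, by linarith⟩ : |vv z| ≤ 4)
      (abs_nonneg _) (by norm_num)
    rw [← abs_mul, sub_mul] at this
    have := abs_le.1 this
    rw [yv, abs_le]; constructor <;> linarith
  · rw [yb, hb3, hc]; field_simp
  · have : y - z = (0, ((l - 1 : ℝ) : ℂ) * z.2) := by
      rw [hy]; ext1
      · simp
      · simp; ring
    rw [this, Prod.norm_mk, norm_zero, norm_mul, Complex.norm_real, Real.norm_eq_abs]
    have hv := gz.v
    refine max_le (by positivity) ?_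
    calc |l - 1| * ‖z.2‖ ≤ (3:ℝ) / (N:ℝ) * 2 := by gcongr
      _ ≤ 10 / N := by rw [div_mul_eq_mul_div]; gcongr; norm_num

/-- rotation -/
noncomputable def rot (u : ℂ) (z : ℂ × ℂ) : ℂ × ℂ := (u * z.1, u * z.2)

lemma rr_rot {u : ℂ} (hu : ‖u‖ = 1) (z : ℂ × ℂ) : rr (rot u z) = rr z := by
  simp [rr, rot, hu]
lemma vv_rot {u : ℂ} (hu : ‖u‖ = 1) (z : ℂ × ℂ) : vv (rot u z) = vv z := by
  simp [vv, rot, hu]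
lemma ss_rot {u : ℂ} (hu : ‖u‖ = 1) (z : ℂ × ℂ) : ss (rot u z) = ss z := by
  have h : u.re * u.re + u.im * u.im = 1 := by
    have := Complex.normSq_eq_norm_sq u
    rw [hu, Complex.normSq_apply] at this; linarith
  simp [ss, rot, Complex.mul_re, Complex.mul_im]
  linear_combination (z.1.re * z.2.re + z.1.im * z.2.im) * h
lemma bb_rot {u : ℂ} (hu : ‖u‖ = 1) (z : ℂ × ℂ) : bb (rot u z) = bb z := by
  rw [bb, bb, rr_rot hu, vv_rot hu]
lemma qE_rot {u : ℂ} (hu : ‖u‖ = 1) (z : ℂ × ℂ) (E : ℝ) : qE (rot u z) E = u * qE z E := by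
  rw [qE, qE, rr_rot hu, bb_rot hu, ss_rot hu, rot]; ring
lemma Near.rot {u : ℂ} (hu : ‖u‖ = 1) {z : ℂ × ℂ} {k : ℝ} (h : Near k z) : Near k (rot u z) :=
  ⟨by rw [rr_rot hu]; exact h.r, by rw [ss_rot hu]; exact h.s, by rw [vv_rot hu]; exact h.v⟩

end RC

namespace RC

open Real Set Metric

lemma rE_neg (b r s E : ℝ) : rE b r (-s) (2 * π - E) = rE b r s E := by
  rw [rE, rE, cos_two_pi_sub, sin_two_pi_sub]; ring

lemma Good.neg {b r s : ℝ} (h : Good b r s) : Good b r (-s) := ⟨h.hb, h.hr, by rw [abs_neg]; exact h.hs⟩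

lemma Good.sin_lo {b r s : ℝ} (h : Good b r s) {E : ℝ} (h0 : 0 ≤ E) (h1 : E ≤ π)
    (hr : |rE b r s E - 1| ≤ 1 / 50) : 9 / 10 ≤ sin E := by
  have hs : 0 ≤ sin E := sin_nonneg_of_nonneg_of_le_pi h0 h1
  have e : (b ^ 2 - r) * cos E = b * s * sin E + (b ^ 2 - 1) - (rE b r s E - 1) := by
    rw [rE]; ring
  have h2 := abs_le.1 hr
  have h3 := h.bsq
  have h4 : |b * s * sin E| ≤ 1 / 90 := by
    rw [abs_mul]
    have := mul_le_mul h.bs (abs_sin_le_one E) (abs_nonneg _) (by norm_num)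
    linarith
  have h4 := abs_le.1 h4
  have h5 : |(b ^ 2 - r) * cos E| ≤ 9 / 100 := by
    rw [e, abs_le]; constructor <;> linarith
  have hX := h.X.1
  have h6 : |cos E| ≤ 1 / 5 := by
    rw [abs_mul, abs_of_pos (by linarith)] at h5
    have := mul_le_mul_of_nonneg_right hX (abs_nonneg (cos E))
    linarith
  have h7 : cos E ^ 2 ≤ (1 / 5) ^ 2 := by
    rw [← sq_abs]; gcongr
  have h8 := sin_sq_add_cos_sq E
  nlinarith

lemma Good.branch {b r s : ℝ} (h : Good b r s) {E F : ℝ} (h0 : 0 ≤ E) (h1 : E ≤ π)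
    (h0' : 0 ≤ F) (h1' : F ≤ π) (hF : rE b r s F = 1) (hr : |rE b r s E - 1| ≤ 1 / 50) :
    |E - F| ≤ 5 * |rE b r s E - 1| := by
  have s1 := h.sin_lo h0 h1 hr
  have s2 := h.sin_lo h0' h1' (by rw [hF]; norm_num)
  set m := (E + F) / 2 with hm
  set d := (E - F) / 2 with hd
  have e : rE b r s E - 1 = 2 * sin d * ((b ^ 2 - r) * sin m + b * s * cos m) := by
    rw [← hF, rE, rE]
    have e1 : cos E - cos F = -2 * sin m * sin d := cos_sub_cos E F
    have e2 : sin E - sin F = 2 * sin d * cos m := sin_sub_sin E F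
    linear_combination (r - b ^ 2) * e1 + (b * s) * e2
  have e3 : sin E + sin F = 2 * sin m * cos d := by
    rw [show E = m + d by rw [hm, hd]; ring, show F = m - d by rw [hm, hd]; ring, sin_add, sin_sub]
    ring
  have hms : 0 ≤ sin m := sin_nonneg_of_nonneg_of_le_pi (by linarith) (by linarith)
  have s3 : 9 / 10 ≤ sin m := by
    have := mul_le_mul_of_nonneg_left (cos_le_one d) hms
    linarith
  have h4 : |b * s * cos m| ≤ 1 / 90 := by
    rw [abs_mul]
    have := mul_le_mul h.bs (abs_cos_le_one m) (abs_nonneg _) (by norm_num)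
    linarith
  have h4 := abs_le.1 h4
  have h5 : 39 / 100 ≤ (b ^ 2 - r) * sin m + b * s * cos m := by
    have := mul_le_mul h.X.1 s3 (by norm_num) (by linarith [h.X.1])
    linarith
  have p2 := Real.pi_lt_d2
  have p1 := Real.pi_gt_three
  have h6 : |d| * (5 / 8) ≤ |sin d| := by
    have hj : 2 / π * |d| ≤ sin |d| := by
      apply mul_le_sin (abs_nonneg _)
      rw [hd, abs_le]; constructor <;> linarith
    have : (5:ℝ) / 8 ≤ 2 / π := by rw [le_div_iff₀ pi_pos]; linarith
    have h8 := mul_le_mul_of_nonneg_right this (abs_nonneg d)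
    have h9 : sin |d| ≤ |sin d| := by
      rcases abs_cases d with ⟨h, _⟩ | ⟨h, _⟩
      · rw [h]; exact le_abs_self _
      · rw [h, sin_neg]; exact neg_le_abs _
    linarith
  rw [e, abs_mul, abs_mul, abs_of_pos (by linarith : 0 < (b ^ 2 - r) * sin m + b * s * cos m)]
  have : |E - F| = 2 * |d| := by
    rw [show E - F = 2 * d by rw [hd]; ring, abs_mul]; norm_num
  rw [this]
  have h10 := mul_le_mul h6 h5 (by norm_num) (abs_nonneg _)
  norm_num
  have := abs_nonneg d
  nlinarith

lemma Good.crossings {b r s : ℝ} (h : Good b r s) : ∃ E1 E2 : ℝ, 0 < E1 ∧ E1 < 2 * π ∧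
    rE b r s E1 = 1 ∧ rE b r s E2 = 1 ∧
    ∀ E, 0 ≤ E → E ≤ 2 * π → 1 / 50 ≤ |rE b r s E - 1| ∨ |E - E1| ≤ 5 * |rE b r s E - 1| ∨
      |E - E2| ≤ 5 * |rE b r s E - 1| := by
  have hc : ∀ s, Continuous (rE b r s) :=
    fun s => continuous_iff_continuousAt.2 fun E => (rE_deriv E).continuousAt
  have key : ∀ s, ∃ E ∈ Icc 0 π, rE b r s E = 1 := by
    intro s
    have hs := intermediate_value_Icc pi_pos.le (hc s).continuousOn
    apply hs
    have := h.bsq; have := h.r_hi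
    constructor
    · simp [rE]; linarith
    · simp [rE]; linarith
  obtain ⟨E1, hE1, h1⟩ := key s
  obtain ⟨E2, hE2, h2⟩ := key (-s)
  refine ⟨E1, 2 * π - E2, ?_, by linarith [hE1.2, pi_pos], h1, ?_, ?_⟩
  · rcases hE1.1.eq_or_lt with h0 | h0
    · exfalso
      rw [← h0] at h1
      simp [rE] at h1
      linarith [h.r_hi]
    · exact h0
  · rw [← rE_neg, sub_sub_cancel, h2]
  · intro E h0 h2π
    by_cases hr : 1 / 50 ≤ |rE b r s E - 1|
    · exact Or.inl hr
    · push Not at hr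
      right
      rcases le_total E π with hE | hE
      · left
        exact h.branch h0 hE hE1.1 hE1.2 h1 hr.le
      · right
        have := h.neg.branch (E := 2 * π - E) (by linarith) (by linarith) hE2.1 hE2.2 h2
          (by rw [rE_neg]; exact hr.le)
        rw [rE_neg] at this
        rwa [show E - (2 * π - E2) = -(2 * π - E - E2) by ring, abs_neg]

noncomputable def ei (t : ℝ) : ℂ := Complex.exp (t * Complex.I)

lemma ei_norm (t : ℝ) : ‖ei t‖ = 1 := Complex.norm_exp_ofReal_mul_I t
lemma ei_add (s t : ℝ) : ei (s + t) = ei s * ei t := by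
  rw [ei, ei, ei, ← Complex.exp_add]; push_cast; ring_nf
lemma ei_pow (t : ℝ) (n : ℕ) : ei t ^ n = ei (n * t) := by
  rw [ei, ei, ← Complex.exp_nat_mul]; push_cast; ring_nf
lemma ei_int (n : ℤ) : ei (n * (2 * π)) = 1 := by
  rw [ei, Complex.exp_eq_one_iff]; exact ⟨n, by push_cast; ring⟩
lemma ei_deriv (t : ℝ) : HasDerivAt ei (Complex.I * ei t) t := by
  have h : HasDerivAt (fun t : ℝ => (t : ℂ) * Complex.I) Complex.I t := by
    simpa using (Complex.ofRealCLM.hasDerivAt (x := t)).mul_const Complex.I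
  have := h.cexp
  refine this.congr_deriv ?_
  rw [ei]; ring
lemma ei_sub_one (t : ℝ) : ‖ei t - 1‖ ≤ |t| := by
  have := Real.norm_exp_I_mul_ofReal_sub_one_le (x := t)
  rwa [mul_comm, Real.norm_eq_abs] at this
lemma ei_zero : ei 0 = 1 := by simp [ei]

noncomputable def Psi (z : ℂ × ℂ) (E : ℝ) : ℂ := ei (-(tE (bb z) (rr z) (ss z) E)) * qE z E

lemma Psi_norm {z : ℂ × ℂ} (h : GoodZ z) (E : ℝ) : ‖Psi z E‖ = rE (bb z) (rr z) (ss z) E := by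
  rw [Psi, norm_mul, ei_norm, one_mul, qE_norm h]

lemma Psi_eq {z : ℂ × ℂ} (h : GoodZ z) (t : ℝ) : ei (-t) * (KK z t).1 = Psi z (eK z t) := by
  have : tE (bb z) (rr z) (ss z) (eK z t) = t := (ecc_spec h.g).1 t
  rw [Psi, this, KK]

lemma Psi_add {z : ℂ × ℂ} (E : ℝ) (k : ℤ) :
    Psi z (E + k * (2 * π)) = ei (-(k * (2 * π * bb z ^ 3))) * Psi z E := by
  have e : tE (bb z) (rr z) (ss z) (E + k * (2 * π))
      = tE (bb z) (rr z) (ss z) E + k * (2 * π * bb z ^ 3) := by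
    rw [tE, tE, sin_add_int_mul_two_pi, cos_add_int_mul_two_pi]; ring
  have e2 : qE z (E + k * (2 * π)) = qE z E := by
    rw [qE, qE, fE, gE, fE, gE, sin_add_int_mul_two_pi, cos_add_int_mul_two_pi]
  rw [Psi, Psi, e, e2, neg_add, ei_add]; ring

lemma Psi_lip {z : ℂ × ℂ} (h : GoodZ z) (E F : ℝ) : ‖Psi z E - Psi z F‖ ≤ 50 * |E - F| := by
  have hd : ∀ E, HasDerivAt (Psi z)
      (((-(bb z * rE (bb z) (rr z) (ss z) E) : ℝ) : ℂ) * (Complex.I * ei (-(tE (bb z) (rr z) (ss z) E))) * qE z E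
      + ei (-(tE (bb z) (rr z) (ss z) E)) * (((bb z * rE (bb z) (rr z) (ss z) E : ℝ) : ℂ) * vE z E)) E := by
    intro E
    have d1 : HasDerivAt (fun E => ei (-(tE (bb z) (rr z) (ss z) E)))
        (((-(bb z * rE (bb z) (rr z) (ss z) E) : ℝ) : ℂ) * (Complex.I * ei (-(tE (bb z) (rr z) (ss z) E)))) E := by
      have := (ei_deriv (-(tE (bb z) (rr z) (ss z) E))).scomp E (tE_deriv (b := bb z) (r := rr z) (s := ss z) E).neg
      refine this.congr_deriv ?_
      rw [Complex.real_smul]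
    have d2 : HasDerivAt (qE z) (((bb z * rE (bb z) (rr z) (ss z) E : ℝ) : ℂ) * vE z E) E := by
      have h1 := (((fE_deriv E h.g).ofReal_comp).mul_const z.1).add
        (((gE_deriv E h.g).ofReal_comp).mul_const z.2)
      refine h1.congr_deriv ?_
      rw [vE]; push_cast; ring
    exact d1.mul d2
  have := convex_univ.norm_image_sub_le_of_norm_hasDerivWithin_le (f := Psi z)
      (C := 50) (fun x _ => (hd x).hasDerivWithinAt)
      (fun x _ => ?_) (mem_univ F) (mem_univ E)
  · rwa [Real.norm_eq_abs] at this
  · refine (norm_add_le _ _).trans ?_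
    have h1 := h.g.rE_lo x
    have h2 := h.g.rE_hi x
    have h3 := h.g.b_lo
    have h4 := h.g.b_hi
    have h5 := vE_norm_le h x
    have hp : 0 ≤ bb z * rE (bb z) (rr z) (ss z) x := by positivity
    have hq : bb z * rE (bb z) (rr z) (ss z) x ≤ 51 / 50 * 2 := by gcongr
    rw [norm_mul, norm_mul, norm_mul, norm_mul, norm_mul, ei_norm, Complex.norm_I, qE_norm h,
      Complex.norm_real, Complex.norm_real, Real.norm_eq_abs, Real.norm_eq_abs, abs_neg,
      abs_of_nonneg hp]
    have a1 := mul_le_mul hq h2 (by linarith) (by norm_num)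
    have a2 := mul_le_mul hq h5 (norm_nonneg _) (by norm_num)
    linarith

lemma pow_sub_one_le {w : ℂ} (hw : ‖w‖ = 1) (n : ℕ) : ‖w ^ n - 1‖ ≤ n * ‖w - 1‖ := by
  induction n with
  | zero => simp
  | succ n ih =>
    have : w ^ (n + 1) - 1 = w ^ n * (w - 1) + (w ^ n - 1) := by ring
    rw [this]
    refine (norm_add_le _ _).trans ?_
    rw [norm_mul, norm_pow, hw, one_pow]
    push_cast; linarith

lemma far {z : ℂ × ℂ} (h : GoodZ z) {N p : ℕ} (hN : 0 < N) (hp : bb z ^ 3 * N = p) {E1 E2 : ℝ}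
    (hE1 : rE (bb z) (rr z) (ss z) E1 = 1) (hE2 : rE (bb z) (rr z) (ss z) E2 = 1)
    (hall : ∀ E, 0 ≤ E → E ≤ 2 * π → 1 / 50 ≤ |rE (bb z) (rr z) (ss z) E - 1| ∨
      |E - E1| ≤ 5 * |rE (bb z) (rr z) (ss z) E - 1| ∨
      |E - E2| ≤ 5 * |rE (bb z) (rr z) (ss z) E - 1|)
    (h1 : 1 / 2 ≤ ‖Psi z E1 ^ N - 1‖) (h2 : 1 / 2 ≤ ‖Psi z E2 ^ N - 1‖) (E : ℝ) :
    1 / (502 * N) ≤ ‖Psi z E - 1‖ := by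
  have hNp : (0:ℝ) < N := by exact_mod_cast hN
  have hN1 : (1:ℝ) ≤ N := by exact_mod_cast hN
  obtain ⟨k, E', hE0, hE2π, hEk⟩ : ∃ (k : ℤ) (E' : ℝ), 0 ≤ E' ∧ E' ≤ 2 * π ∧ E = E' + k * (2 * π) := by
    refine ⟨⌊E / (2 * π)⌋, E - ⌊E / (2 * π)⌋ * (2 * π), ?_, ?_, by ring⟩
    · have := Int.floor_le (E / (2 * π))
      rw [le_div_iff₀ (by positivity)] at this; linarith
    · have := (Int.lt_floor_add_one (E / (2 * π))).le
      rw [div_le_iff₀ (by positivity)] at this; linarith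
  have hnE : |rE (bb z) (rr z) (ss z) E' - 1| ≤ ‖Psi z E - 1‖ := by
    have e : ‖Psi z E‖ = rE (bb z) (rr z) (ss z) E' := by
      rw [hEk, Psi_add, norm_mul, ei_norm, one_mul, Psi_norm h]
    rw [← e]
    simpa using abs_norm_sub_norm_le (Psi z E) 1
  have branch : ∀ F, rE (bb z) (rr z) (ss z) F = 1 → 1 / 2 ≤ ‖Psi z F ^ N - 1‖ →
      |E' - F| ≤ 5 * |rE (bb z) (rr z) (ss z) E' - 1| → 1 / (502 * N) ≤ ‖Psi z E - 1‖ := by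
    intro F hF hFN hd
    set w := ei (-(k * (2 * π * bb z ^ 3))) with hw
    have hwN : w ^ N = 1 := by
      rw [hw, ei_pow, ← ei_int (-(k * p))]
      congr 1
      push_cast
      rw [← hp]; ring
    have hx : ‖w * Psi z F‖ = 1 := by rw [norm_mul, hw, ei_norm, Psi_norm h, hF, one_mul]
    have a1 := pow_sub_one_le hx N
    rw [mul_pow, hwN, one_mul] at a1
    have a2 := Psi_lip h E' F
    have a3 : ‖w * Psi z F - 1‖ ≤ ‖Psi z E - 1‖ + ‖Psi z E' - Psi z F‖ := by
      have : w * Psi z F - 1 = (Psi z E - 1) - w * (Psi z E' - Psi z F) := by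
        rw [hEk, Psi_add]; ring
      rw [this]
      refine (norm_sub_le _ _).trans ?_
      rw [norm_mul, hw, ei_norm, one_mul]
    have a4 : ‖w * Psi z F - 1‖ ≤ 251 * ‖Psi z E - 1‖ := by linarith
    have a5 : 1 / 2 ≤ N * (251 * ‖Psi z E - 1‖) := by
      have := mul_le_mul_of_nonneg_left a4 hNp.le
      linarith
    rw [div_le_iff₀ (by positivity)]
    linarith
  rcases hall E' hE0 hE2π with h3 | h3 | h3
  · refine le_trans ?_ (h3.trans hnE)
    rw [div_le_div_iff₀ (by positivity) (by norm_num)]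
    linarith
  · exact branch E1 hE1 h1 h3
  · exact branch E2 hE2 h2 h3

lemma pigeon {a b : ℂ} (ha : ‖a‖ = 1) (hb : ‖b‖ = 1) : ∃ j : ℕ, j ≤ 2 ∧
    1 / 2 ≤ ‖ei (j * (π / 2)) * a - 1‖ ∧ 1 / 2 ≤ ‖ei (j * (π / 2)) * b - 1‖ := by
  have e0 : ei ((0:ℕ) * (π / 2)) = 1 := by simp [ei]
  have e1 : ei ((1:ℕ) * (π / 2)) = Complex.I := by
    simp [ei, Complex.exp_pi_div_two_mul_I]
  have e2 : ei ((2:ℕ) * (π / 2)) = -1 := by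
    rw [ei, ← Complex.exp_pi_mul_I]; push_cast; ring_nf
  have n1 : 1 ≤ ‖(1:ℂ) - Complex.I‖ := by
    have := Complex.abs_re_le_norm ((1:ℂ) - Complex.I); simpa using this
  have n2 : 1 ≤ ‖(-1:ℂ) - Complex.I‖ := by
    have := Complex.abs_re_le_norm ((-1:ℂ) - Complex.I); simpa using this
  have n3 : 1 ≤ ‖(1:ℂ) - (-1)‖ := by norm_num
  have key : ∀ u v c : ℂ, ‖c‖ = 1 → 1 ≤ ‖u - v‖ → ‖u * c - 1‖ < 1 / 2 → ‖v * c - 1‖ < 1 / 2 → False := by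
    intro u v c hc h1 h2 h3
    have : ‖u - v‖ = ‖(u * c - 1) - (v * c - 1)‖ := by
      rw [show (u * c - 1) - (v * c - 1) = (u - v) * c by ring, norm_mul, hc, mul_one]
    have := norm_sub_le (u * c - 1) (v * c - 1)
    linarith
  by_contra hcon
  push Not at hcon
  have c0 := hcon 0 (by norm_num)
  have c1 := hcon 1 (by norm_num)
  have c2 := hcon 2 (by norm_num)
  rw [e0] at c0
  rw [e1] at c1
  rw [e2] at c2
  have k1 := key 1 Complex.I a ha n1
  have k2 := key (-1) Complex.I a ha n2
  have k3 := key 1 (-1) a ha n3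
  have l1 := key 1 Complex.I b hb n1
  have l2 := key (-1) Complex.I b hb n2
  have l3 := key 1 (-1) b hb n3
  by_cases x0 : 1 / 2 ≤ ‖1 * a - 1‖ <;> by_cases x1 : 1 / 2 ≤ ‖Complex.I * a - 1‖ <;>
    by_cases x2 : 1 / 2 ≤ ‖-1 * a - 1‖ <;> grind

lemma hit {N p : ℕ} (hN : 0 < N) (hpN : Nat.Coprime p N) {w : ℂ} (hw : ‖w‖ = 1) :
    ∃ k : ℕ, k < N ∧ ‖ei (-(k * (2 * π * (p / N)))) * w - 1‖ ≤ 7 / N := by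
  have hNp : (0:ℝ) < N := by exact_mod_cast hN
  have hwe : w = ei (Complex.arg w) := by
    have := Complex.norm_mul_exp_arg_mul_I w
    rw [hw] at this; rw [ei]; simpa using this.symm
  set θ := Complex.arg w
  set m : ℤ := ⌊N * θ / (2 * π)⌋ with hm
  have f1 : (m:ℝ) * (2 * π) ≤ N * θ := by
    have := Int.floor_le (N * θ / (2 * π)); rwa [le_div_iff₀ (by positivity)] at this
  have f2 : (N:ℝ) * θ ≤ (m + 1) * (2 * π) := by
    have := (Int.lt_floor_add_one (N * θ / (2 * π))).le; rwa [div_le_iff₀ (by positivity)] at this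
  have bez := Nat.gcd_eq_gcd_ab p N
  rw [hpN.gcd_eq_one] at bez
  set u := Nat.gcdA p N
  set v := Nat.gcdB p N
  have hN0 : (N:ℤ) ≠ 0 := by exact_mod_cast hN.ne'
  set kz : ℤ := (u * m) % N with hkz
  have kz0 : 0 ≤ kz := Int.emod_nonneg _ hN0
  have kz1 : kz < N := Int.emod_lt_of_pos _ (by exact_mod_cast hN)
  obtain ⟨k, hk⟩ := Int.eq_ofNat_of_zero_le kz0
  refine ⟨k, by omega, ?_⟩
  set d := (u * m) / (N:ℤ) with hd
  have hdiv : (kz:ℤ) + N * d = u * m := Int.emod_add_mul_ediv _ _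
  -- k p = m - N (v m + d p)
  have hkp : (k:ℤ) * p = m - N * (v * m + d * p) := by
    have : (k:ℤ) = kz := by rw [hk]
    rw [this]
    have : kz = u * m - N * d := by linarith
    rw [this]
    have bez' : (1:ℤ) = p * u + N * v := by exact_mod_cast bez
    linear_combination (-m) * bez'
  have hkp' : (k:ℝ) * p = m - N * (v * m + d * p) := by exact_mod_cast hkp
  have e : ei (-(k * (2 * π * (p / N)))) * w = ei (θ - m * (2 * π) / N) := by
    rw [hwe, ← ei_add, ← mul_one (ei (θ - m * (2 * π) / N)), ← ei_int (v * m + d * p), ← ei_add]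
    congr 1
    have hNne : (N:ℝ) ≠ 0 := hNp.ne'
    push_cast
    field_simp
    linear_combination (-2 * π) * hkp'
  rw [e]
  refine (ei_sub_one _).trans ?_
  have p2 := Real.pi_lt_d2
  have : θ - m * (2 * π) / N = (N * θ - m * (2 * π)) / N := by field_simp
  rw [this, abs_div, abs_of_pos hNp]
  gcongr
  rw [abs_le]; constructor <;> linarith

/-- Summary of the Kepler part. -/
lemma kepler_summary {z : ℂ × ℂ} (h : Near (1 / 2000) z) {j : ℕ} (hN : 100000 ≤ 2 ^ j) :
    ∃ (y : ℂ × ℂ) (p : ℕ) (T' : ℝ), Near (1 / 1000) y ∧ bb y ^ 3 * (2 ^ j : ℕ) = p ∧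
      ‖y - z‖ ≤ 20 / (2 ^ j : ℕ) ∧
      (∀ t, 1 / (502 * (2 ^ j : ℕ)) ≤ ‖ei (-t) * (KK y t).1 - 1‖) ∧
      0 < T' ∧ T' < (2 ^ j : ℕ) * tau y ∧ ‖ei (-T') * (KK y T').1 - 1‖ ≤ 7 / (2 ^ j : ℕ) := by
  obtain ⟨y, p, hodd, hy, hp, hyz⟩ := exists_rational h hN
  set N := 2 ^ j with hNdef
  have hN0 : 0 < N := by omega
  have hNp : (0:ℝ) < N := by exact_mod_cast hN0
  have gy := (hy.mono (by norm_num : (1:ℝ) / 1000 ≤ 1 / 500)).good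
  obtain ⟨E1, E2, hE10, hE1π, hE1, hE2, hall⟩ := gy.g.crossings
  have n1 : ‖Psi y E1 ^ N‖ = 1 := by rw [norm_pow, Psi_norm gy, hE1, one_pow]
  have n2 : ‖Psi y E2 ^ N‖ = 1 := by rw [norm_pow, Psi_norm gy, hE2, one_pow]
  obtain ⟨i, hi, hi1, hi2⟩ := pigeon n1 n2
  set u := ei (i * (π / 2) / N) with hu
  have hun : ‖u‖ = 1 := ei_norm _
  have huN : u ^ N = ei (i * (π / 2)) := by
    rw [hu, ei_pow]; congr 1; field_simp
  set y' := rot u y with hy'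
  have hyn : Near (1 / 1000) y' := hy.rot hun
  have gy' := (hyn.mono (by norm_num : (1:ℝ) / 1000 ≤ 1 / 500)).good
  have hb : bb y' = bb y := bb_rot hun y
  have hr : rr y' = rr y := rr_rot hun y
  have hs : ss y' = ss y := ss_rot hun y
  have hP : ∀ E, Psi y' E = u * Psi y E := by
    intro E
    rw [Psi, Psi, hb, hr, hs, hy', qE_rot hun]; ring
  have hfar : ∀ E, 1 / (502 * N) ≤ ‖Psi y' E - 1‖ := by
    refine far gy' hN0 (by rw [hb, hp]) (E1 := E1) (E2 := E2) ?_ ?_ ?_ ?_ ?_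
    · rw [hb, hr, hs, hE1]
    · rw [hb, hr, hs, hE2]
    · rw [hb, hr, hs]; exact hall
    · rw [hP, mul_pow, huN]; exact hi1
    · rw [hP, mul_pow, huN]; exact hi2
  have hcop : Nat.Coprime p N := by
    rw [hNdef]
    exact (Nat.coprime_two_right.2 hodd).pow_right j
  obtain ⟨k, hk, hkh⟩ := hit hN0 hcop (w := Psi y' E1) (by rw [Psi_norm gy', hb, hr, hs, hE1])
  have hbp : bb y' ^ 3 = p / N := by rw [hb, ← hp]; field_simp
  have hEK : ∀ E, eK y' (tE (bb y') (rr y') (ss y') E) = E := (ecc_spec gy'.g).2.1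
  refine ⟨y', p, tE (bb y') (rr y') (ss y') (E1 + (k:ℤ) * (2 * π)), hyn, by rw [hb, hp], ?_, ?_, ?_, ?_, ?_⟩
  · have e1 : y' - y = ((u - 1) * y.1, (u - 1) * y.2) := by
      rw [hy', rot]; ext1 <;> simp <;> ring
    have hu1 : ‖u - 1‖ ≤ 4 / N := by
      refine (ei_sub_one _).trans ?_
      have hi' : (i:ℝ) ≤ 2 := by exact_mod_cast hi
      have p2 := Real.pi_lt_d2
      rw [abs_of_nonneg (by positivity)]
      gcongr
      nlinarith [pi_pos]
    have a1 : ‖y' - y‖ ≤ 8 / N := by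
      have b1 : ‖y.1‖ ≤ 2 := by have := gy.g.r_hi; rw [rr] at this; linarith
      have b2 := gy.v
      rw [e1, Prod.norm_mk, norm_mul, norm_mul]
      have : (8:ℝ) / N = 4 / N * 2 := by ring
      rw [this]
      refine max_le ?_ ?_ <;> gcongr
    have := norm_sub_le_norm_sub_add_norm_sub y' y z
    calc ‖y' - z‖ ≤ 8 / N + 10 / N := by linarith
      _ = 18 / N := by ring
      _ ≤ 20 / N := by gcongr; norm_num
  · intro t
    rw [Psi_eq gy']; exact hfar _
  · rw [← tE_zero (b := bb y') (r := rr y') (s := ss y')]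
    apply gy'.g.tE_mono
    have : (0:ℝ) ≤ ((k:ℤ):ℝ) * (2 * π) := by push_cast; positivity
    linarith
  · have : (N:ℝ) * tau y' = tE (bb y') (rr y') (ss y') (0 + (N:ℤ) * (2 * π)) := by
      rw [tE, sin_add_int_mul_two_pi, cos_add_int_mul_two_pi, tau]; simp; ring
    rw [this]
    apply gy'.g.tE_mono
    have : ((k:ℝ) + 1) ≤ N := by exact_mod_cast hk
    push_cast
    nlinarith [pi_pos]
  · rw [Psi_eq gy', hEK, Psi_add, hbp]
    exact_mod_cast hkh

end RC

namespace RC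

open Real Set Metric

lemma ode_exists {E : Type*} [NormedAddCommGroup E] [NormedSpace ℝ E] [CompleteSpace E]
    {f : ℝ → E → E} {K B : NNReal} (hl : ∀ t, LipschitzWith K (f t))
    (hc : ∀ x, Continuous (f · x)) (hB : ∀ t x, ‖f t x‖ ≤ B) (x₀ : E) {S : ℝ} (hS : 0 ≤ S) :
    ∃ α : ℝ → E, α 0 = x₀ ∧ ∀ t ∈ Icc 0 S, HasDerivAt α (f t (α t)) t := by
  have hpl : IsPicardLindelof f (tmin := -1) (tmax := S + 1)
      ⟨0, by constructor <;> linarith⟩ x₀ (B * ⟨S + 1, by linarith⟩) 0 B K := by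
    refine ⟨fun t _ => (hl t).lipschitzOnWith, fun x _ => (hc x).continuousOn,
      fun t _ x _ => hB t x, ?_⟩
    have : max (S + 1 - 0) (0 - (-1)) = S + 1 := by
      rw [max_eq_left] <;> linarith
    simp only [this]
    change (B : ℝ) * (S + 1) ≤ (B : ℝ) * (S + 1) - 0
    simp
  obtain ⟨α, h0, h1⟩ := hpl.exists_eq_forall_mem_Icc_hasDerivWithinAt₀
  refine ⟨α, h0, fun t ht => ?_⟩
  exact (h1 t ⟨by linarith [ht.1], by linarith [ht.2]⟩).hasDerivAt
    (Icc_mem_nhds (by linarith [ht.1]) (by linarith [ht.2]))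

noncomputable def GP (μ d t : ℝ) (z : ℂ × ℂ) : ℂ × ℂ :=
  (cl z.2, -((1 - μ : ℝ) : ℂ) * nc (1 / 4) (z.1 + μ * ei t)
    - (μ : ℂ) * nc d (z.1 - ((1 - μ : ℝ) : ℂ) * ei t))

lemma GP_sub {μ d : ℝ} (hμ : 0 < μ) (hd : 0 < d) (t : ℝ) (z : ℂ × ℂ) :
    ‖GP μ d t z - FK z‖ ≤ 272 * μ + μ / d ^ 2 := by
  have e : GP μ d t z - FK z = (0, (μ : ℂ) * nc (1 / 4) (z.1 + μ * ei t)
      - (nc (1 / 4) (z.1 + μ * ei t) - nc (1 / 4) z.1)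
      - (μ : ℂ) * nc d (z.1 - ((1 - μ : ℝ) : ℂ) * ei t)) := by
    rw [GP, FK]
    ext1
    · simp
    · simp; ring
  have h1 : ‖(μ : ℂ) * nc (1 / 4) (z.1 + μ * ei t)‖ ≤ 16 * μ := by
    rw [norm_mul, Complex.norm_real, Real.norm_eq_abs, abs_of_pos hμ]
    have := nc_norm_le (by norm_num : (0:ℝ) < 1 / 4) (z.1 + μ * ei t)
    norm_num at this ⊢
    nlinarith
  have h2 : ‖(nc (1 / 4) (z.1 + μ * ei t) - nc (1 / 4) z.1)‖ ≤ 256 * μ := by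
    have := nc_lip (by norm_num : (0:ℝ) < 1 / 4) (z.1 + μ * ei t) z.1
    rw [add_sub_cancel_left, norm_mul, Complex.norm_real, Real.norm_eq_abs, abs_of_pos hμ,
      ei_norm] at this
    norm_num at this ⊢
    linarith
  have h3 : ‖(μ : ℂ) * nc d (z.1 - ((1 - μ : ℝ) : ℂ) * ei t)‖ ≤ μ / d ^ 2 := by
    rw [norm_mul, Complex.norm_real, Real.norm_eq_abs, abs_of_pos hμ, div_eq_mul_one_div]
    exact mul_le_mul_of_nonneg_left (nc_norm_le hd _) hμ.le
  rw [e, Prod.norm_def]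
  have hp : 0 ≤ μ / d ^ 2 := by positivity
  refine max_le (by simp; positivity) ?_
  refine (norm_sub_le _ _).trans ?_
  have := norm_sub_le ((μ : ℂ) * nc (1 / 4) (z.1 + μ * ei t))
    (nc (1 / 4) (z.1 + μ * ei t) - nc (1 / 4) z.1)
  linarith

lemma nc_cont {c : ℝ} (hc : 0 < c) : Continuous (nc c) := by
  have : LipschitzWith (Real.toNNReal (4 / c ^ 3)) (nc c) := by
    apply LipschitzWith.of_dist_le_mul
    intro x y
    rw [dist_eq_norm, dist_eq_norm, Real.coe_toNNReal _ (by positivity)]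
    exact nc_lip hc x y
  exact this.continuous

lemma ei_cont : Continuous ei := by
  have : ∀ t, HasDerivAt ei (Complex.I * ei t) t := ei_deriv
  exact continuous_iff_continuousAt.2 fun t => (this t).continuousAt

lemma GP_cont {μ d : ℝ} (hd : 0 < d) (z : ℂ × ℂ) : Continuous (GP μ d · z) := by
  unfold GP
  have h1 := nc_cont hd
  have h2 := nc_cont (by norm_num : (0:ℝ) < 1 / 4)
  have h3 := ei_cont
  fun_prop

lemma GP_lip {μ d : ℝ} (hμ : 0 < μ) (hμ1 : μ < 1) (hd : 0 < d) :
    ∃ K : NNReal, ∀ t, LipschitzWith K (GP μ d t) := by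
  refine ⟨Real.toNNReal (2 + 256 + 4 / d ^ 3), fun t => ?_⟩
  apply LipschitzWith.of_dist_le_mul
  intro x y
  rw [dist_eq_norm, dist_eq_norm, Real.coe_toNNReal _ (by positivity)]
  have n1 : ‖x.1 - y.1‖ ≤ ‖x - y‖ := by rw [← Prod.fst_sub]; exact norm_fst_le _
  have n2 : ‖x.2 - y.2‖ ≤ ‖x - y‖ := by rw [← Prod.snd_sub]; exact norm_snd_le _
  have hp : 0 ≤ 4 / d ^ 3 := by positivity
  have hn := norm_nonneg (x - y)
  have a1 := cl_lip x.2 y.2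
  have a2 := nc_lip (by norm_num : (0:ℝ) < 1 / 4) (x.1 + μ * ei t) (y.1 + μ * ei t)
  have a3 := nc_lip hd (x.1 - ((1 - μ : ℝ) : ℂ) * ei t) (y.1 - ((1 - μ : ℝ) : ℂ) * ei t)
  rw [add_sub_add_right_eq_sub] at a2
  rw [sub_sub_sub_cancel_right] at a3
  have e : GP μ d t x - GP μ d t y = (cl x.2 - cl y.2,
      -((1 - μ : ℝ) : ℂ) * (nc (1 / 4) (x.1 + μ * ei t) - nc (1 / 4) (y.1 + μ * ei t))
      - (μ : ℂ) * (nc d (x.1 - ((1 - μ : ℝ) : ℂ) * ei t)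
        - nc d (y.1 - ((1 - μ : ℝ) : ℂ) * ei t))) := by
    rw [GP, GP]
    ext1
    · simp
    · simp only [Prod.snd_sub]; ring
  have b2 : ‖-((1 - μ : ℝ) : ℂ) * (nc (1 / 4) (x.1 + μ * ei t) - nc (1 / 4) (y.1 + μ * ei t))‖
      ≤ 256 * ‖x - y‖ := by
    rw [norm_mul, norm_neg, Complex.norm_real, Real.norm_eq_abs, abs_of_pos (by linarith)]
    norm_num at a2 ⊢
    have := norm_nonneg (nc (1 / 4) (x.1 + μ * ei t) - nc (1 / 4) (y.1 + μ * ei t))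
    norm_num at this
    nlinarith
  have b3 : ‖(μ : ℂ) * (nc d (x.1 - ((1 - μ : ℝ) : ℂ) * ei t)
        - nc d (y.1 - ((1 - μ : ℝ) : ℂ) * ei t))‖ ≤ 4 / d ^ 3 * ‖x - y‖ := by
    rw [norm_mul, Complex.norm_real, Real.norm_eq_abs, abs_of_pos hμ]
    have := norm_nonneg (nc d (x.1 - ((1 - μ : ℝ) : ℂ) * ei t)
        - nc d (y.1 - ((1 - μ : ℝ) : ℂ) * ei t))
    have := mul_le_mul_of_nonneg_left n1 hp
    nlinarith
  have hp' := mul_nonneg hp hn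
  rw [e, Prod.norm_def]
  refine max_le (by simp only; nlinarith) ?_
  refine (norm_sub_le _ _).trans ?_
  nlinarith

noncomputable def C0 : ℝ :=
  exp ((256 : NNReal) * 10) + exp ((256 : NNReal) * 10) ^ 2 + 20 * 600 * exp ((256 : NNReal) * 10)

lemma perturbed {y : ℂ × ℂ} (hy : Near (1 / 1000) y) {N : ℕ} (hN : 100000 ≤ N) {μ : ℝ}
    (hμ : 0 < μ) (hκ : C0 * 10 ^ 10 * N ^ 5 * μ ≤ 1)
    (hfar : ∀ t, 1 / (502 * (N : ℝ)) ≤ ‖ei (-t) * (KK y t).1 - 1‖) :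
    ∃ z : ℝ → ℂ × ℂ, z 0 = y ∧ ∀ t ∈ Icc 0 (N * tau y), ‖z t - KK y t‖ ≤ 1 / (2000 * N) ∧
      HasDerivAt z ((z t).2, -((1 - μ : ℝ) : ℂ) *
        (((1 / ‖(z t).1 + μ * ei t‖ ^ 3 : ℝ) : ℂ) * ((z t).1 + μ * ei t))
        - (μ : ℂ) * (((1 / ‖(z t).1 - ((1 - μ : ℝ) : ℂ) * ei t‖ ^ 3 : ℝ) : ℂ) *
          ((z t).1 - ((1 - μ : ℝ) : ℂ) * ei t))) t := by
  have hNr : (100000 : ℝ) ≤ N := by exact_mod_cast hN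
  have hNp : (0 : ℝ) < N := by linarith
  have gy := (hy.mono (by norm_num : (1:ℝ) / 1000 ≤ 1 / 500)).good
  set X := exp ((256 : NNReal) * 10) with hX
  have hX1 : 1 ≤ X := Real.one_le_exp (by positivity)
  have hC : C0 = X + X ^ 2 + 20 * 600 * X := rfl
  have hC1 : 1 ≤ C0 := by rw [hC]; nlinarith
  have hCX : X ≤ C0 := by rw [hC]; nlinarith
  have hCX' : 600 * X ≤ C0 := by rw [hC]; nlinarith
  have hμN : μ * (10 ^ 10 * N ^ 5) ≤ 1 := by
    have h0 : 0 ≤ μ * (10 ^ 10 * N ^ 5) := by positivity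
    have := mul_le_mul_of_nonneg_right hC1 h0
    linarith
  have hμ1 : μ * (10 ^ 10 * N) ≤ 1 := by
    have : (N : ℝ) ≤ N ^ 5 := le_self_pow₀ (by linarith) (by norm_num)
    refine le_trans ?_ hμN
    gcongr
  have hμs : μ ≤ 1 / (10 ^ 10 * N) := by rw [le_div_iff₀ (by positivity)]; exact hμ1
  have hμ2 : μ ≤ 1 / 10 ^ 10 := by
    refine hμs.trans ?_
    gcongr
    linarith
  set d : ℝ := 1 / (1004 * N) with hd
  have hdp : 0 < d := by positivity
  set ε : ℝ := 272 * μ + μ / d ^ 2 with hε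
  have hε0 : 0 ≤ ε := by positivity
  have hεb : ε ≤ 1100000 * N ^ 2 * μ := by
    have e : μ / d ^ 2 = 1008016 * N ^ 2 * μ := by rw [hd]; field_simp; norm_num
    rw [hε, e]
    nlinarith [mul_pos hμ hNp]
  obtain ⟨K, hK⟩ := GP_lip hμ (by linarith) hdp
  have hB : ∀ t x, ‖GP μ d t x‖ ≤ (Real.toNNReal (20 + ε) : NNReal) := by
    intro t x
    rw [Real.coe_toNNReal _ (by positivity)]
    have h1 := GP_sub hμ hdp t x
    have h2 := FK_norm_le x
    have h3 := norm_add_le (GP μ d t x - FK x) (FK x)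
    rw [sub_add_cancel] at h3
    linarith
  obtain ⟨z, hz0, hz⟩ := ode_exists hK (GP_cont hdp) hB y
    (S := 10 * (N + 2)) (by positivity)
  have hbig : C0 * (N + 1) ^ 2 * ε ≤ 1 / (2000 * N) := by
    rw [le_div_iff₀ (by positivity)]
    have h1 : ((N : ℝ) + 1) ^ 2 ≤ 4 * N ^ 2 := by nlinarith
    calc C0 * (N + 1) ^ 2 * ε * (2000 * N)
        ≤ C0 * (4 * N ^ 2) * (1100000 * N ^ 2 * μ) * (2000 * N) := by gcongr
      _ = C0 * 8800000000 * N ^ 5 * μ := by ring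
      _ ≤ C0 * 10 ^ 10 * N ^ 5 * μ := by gcongr; norm_num
      _ ≤ 1 := hκ
  have hsm : (1 : ℝ) / (2000 * N) ≤ 1 / 200000000 := by
    gcongr; linarith
  have hsh := shadow (F := FK) (L := 256) (M := 20) (ρ := 1 / 10000) (A := 600) (K := KK)
    (τ := tau) (y := y) (z := z) (z' := fun t => GP μ d t (z t)) (ε := ε) (by norm_num)
    FK_lip FK_norm_le (by norm_num) (by norm_num)
    (fun ζ h => KK_zero (hy.ball (by simpa [dist_eq_norm] using h)).good)
    (fun ζ h t => KK_deriv (hy.ball (by simpa [dist_eq_norm] using h)).good t)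
    (fun ζ h => by
      have g := (hy.ball (by simpa [dist_eq_norm] using h)).good
      have := KK_per g 0
      rw [zero_add, KK_zero g] at this
      exact this)
    (fun ζ h => tau_bounds (hy.ball (by simpa [dist_eq_norm] using h)).good)
    (fun ζ h => tau_lip (hy.mono (by norm_num)) (hy.ball (by simpa [dist_eq_norm] using h)))
    (fun t => KK_per gy t) N hε0 hz (fun t _ => GP_sub hμ hdp t (z t)) hz0
    (by
      have : X * ε * (N + 1) ≤ C0 * (N + 1) ^ 2 * ε := by
        have h1 : (N : ℝ) + 1 ≤ (N + 1) ^ 2 := by nlinarith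
        calc X * ε * (N + 1) ≤ C0 * ε * (N + 1) ^ 2 := by gcongr
          _ = _ := by ring
      change X * ε * (N + 1) ≤ _
      linarith)
    (by
      change 600 * X * ε * (N + 1) ^ 2 ≤ 1
      have : 600 * X * ε * (N + 1) ^ 2 ≤ C0 * ε * (N + 1) ^ 2 := by gcongr
      have e : C0 * ε * (N + 1) ^ 2 = C0 * (N + 1) ^ 2 * ε := by ring
      linarith)
  refine ⟨z, hz0, fun t ht => ?_⟩
  have hst : ‖z t - KK y t‖ ≤ 1 / (2000 * N) := (hsh t ht).trans hbig
  refine ⟨hst, ?_⟩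
  have hτ := tau_bounds gy
  have ht' : t ∈ Icc (0:ℝ) (10 * (N + 2)) := ⟨ht.1, ht.2.trans (by nlinarith)⟩
  have n1 : ‖(z t).1 - (KK y t).1‖ ≤ 1 / (2000 * N) := by
    rw [← Prod.fst_sub]; exact (norm_fst_le _).trans hst
  have n2 : ‖(z t).2 - (KK y t).2‖ ≤ 1 / (2000 * N) := by
    rw [← Prod.snd_sub]; exact (norm_snd_le _).trans hst
  have kq : 39 / 100 ≤ ‖(KK y t).1‖ := by
    change _ ≤ ‖qE y (eK y t)‖
    rw [qE_norm gy]; exact gy.g.rE_lo _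
  have kv : ‖(KK y t).2‖ ≤ 19 := vE_norm_le gy _
  have hμe : ‖(μ : ℂ) * ei t‖ = μ := by
    rw [norm_mul, Complex.norm_real, ei_norm, Real.norm_eq_abs, abs_of_pos hμ, mul_one]
  have c1 : ‖(z t).2‖ ≤ 20 := by
    have := norm_add_le ((z t).2 - (KK y t).2) (KK y t).2
    rw [sub_add_cancel] at this
    linarith
  have c2 : 1 / 4 ≤ ‖(z t).1 + μ * ei t‖ := by
    have := norm_sub_le ((z t).1 + μ * ei t) (((z t).1 - (KK y t).1) + μ * ei t)
    have e : ((z t).1 + μ * ei t) - (((z t).1 - (KK y t).1) + μ * ei t) = (KK y t).1 := by ring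
    rw [e] at this
    have h2 := norm_add_le ((z t).1 - (KK y t).1) (μ * ei t)
    linarith
  have c3 : d ≤ ‖(z t).1 - ((1 - μ : ℝ) : ℂ) * ei t‖ := by
    have e0 : ei (-t) * ei t = 1 := by rw [← ei_add]; simp [ei_zero]
    have h1 : ‖ei (-t) * (KK y t).1 - 1‖ = ‖(KK y t).1 - ei t‖ := by
      rw [← e0, ← mul_sub, norm_mul, ei_norm, one_mul]
    have h2 := hfar t
    rw [h1] at h2
    have e : (KK y t).1 - ei t = ((z t).1 - ((1 - μ : ℝ) : ℂ) * ei t)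
        - (((z t).1 - (KK y t).1) + μ * ei t) := by push_cast; ring
    rw [e] at h2
    have h3 := norm_sub_le ((z t).1 - ((1 - μ : ℝ) : ℂ) * ei t)
      (((z t).1 - (KK y t).1) + μ * ei t)
    have h4 := norm_add_le ((z t).1 - (KK y t).1) (μ * ei t)
    have f : ∀ a : ℝ, 1 / (a * N) = (1 / a) * (1 / N) := fun a => by rw [one_div_mul_one_div]
    have hpos : 0 < 1 / (N:ℝ) := by positivity
    rw [hd, f]
    rw [f] at h2 hμs n1
    norm_num at *
    linarith
  have := hz t ht'
  rw [GP, cl_eq c1, nc_eq c2, nc_eq c3] at this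
  exact this

end RC

namespace RC

open Real Set Metric

lemma norm2_eq (w : ℂ) : norm2 w.re w.im = ‖w‖ := by
  rw [norm2, Complex.norm_eq_sqrt_sq_add_sq]

lemma ei_neg_deriv (t : ℝ) : HasDerivAt (fun t => ei (-t)) (-(Complex.I * ei (-t))) t := by
  have := (ei_deriv (-t)).scomp t (hasDerivAt_neg t)
  simp only [neg_smul, one_smul] at this
  exact this

lemma re_deriv {f : ℝ → ℂ} {f' : ℂ} {t : ℝ} (h : HasDerivAt f f' t) :
    HasDerivAt (fun t => (f t).re) f'.re t := Complex.reCLM.hasFDerivAt.comp_hasDerivAt t h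

lemma im_deriv {f : ℝ → ℂ} {f' : ℂ} {t : ℝ} (h : HasDerivAt f f' t) :
    HasDerivAt (fun t => (f t).im) f'.im t := Complex.imCLM.hasFDerivAt.comp_hasDerivAt t h

lemma sol_of {μ : ℝ} {z : ℝ → ℂ × ℂ} {s : Set ℝ} (h : ∀ t ∈ s,
      HasDerivAt z ((z t).2, -((1 - μ : ℝ) : ℂ) *
        (((1 / ‖(z t).1 + μ * ei t‖ ^ 3 : ℝ) : ℂ) * ((z t).1 + μ * ei t))
        - (μ : ℂ) * (((1 / ‖(z t).1 - ((1 - μ : ℝ) : ℂ) * ei t‖ ^ 3 : ℝ) : ℂ) *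
          ((z t).1 - ((1 - μ : ℝ) : ℂ) * ei t))) t) :
    IsRCP3BPSol μ s (fun t => (ei (-t) * (z t).1).re) (fun t => (ei (-t) * (z t).1).im)
      (fun t => (ei (-t) * (z t).2).re) (fun t => (ei (-t) * (z t).2).im) := by
  intro t ht
  have hz := h t ht
  have d1 := (ei_neg_deriv t).mul hz.fst
  have d2 := (ei_neg_deriv t).mul hz.snd
  simp only at d1 d2
  beta_reduce
  set q := (z t).1
  set v := (z t).2
  have e0 : ei (-t) * ei t = 1 := by rw [← ei_add]; simp [ei_zero]
  have m1 : ei (-t) * (q + μ * ei t) = ei (-t) * q + μ := by linear_combination (μ : ℂ) * e0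
  have m2 : ei (-t) * (q - ((1 - μ : ℝ) : ℂ) * ei t) = ei (-t) * q - ((1 - μ : ℝ) : ℂ) := by
    linear_combination (-((1 - μ : ℝ) : ℂ)) * e0
  have n1 : ‖q + μ * ei t‖ = ‖ei (-t) * q + μ‖ := by
    rw [← m1, norm_mul, ei_norm, one_mul]
  have n2 : ‖q - ((1 - μ : ℝ) : ℂ) * ei t‖ = ‖ei (-t) * q - ((1 - μ : ℝ) : ℂ)‖ := by
    rw [← m2, norm_mul, ei_norm, one_mul]
  rw [n1, n2] at d2
  have k1 : norm2 ((ei (-t) * q).re + μ) (ei (-t) * q).im = ‖ei (-t) * q + μ‖ := by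
    rw [← norm2_eq]; simp
  have k2 : norm2 ((ei (-t) * q).re - (1 - μ)) (ei (-t) * q).im
      = ‖ei (-t) * q - ((1 - μ : ℝ) : ℂ)‖ := by
    rw [← norm2_eq, Complex.sub_re, Complex.sub_im, Complex.ofReal_re, Complex.ofReal_im, sub_zero]
  have d1' : HasDerivAt (fun t => ei (-t) * (z t).1)
      (-Complex.I * (ei (-t) * q) + ei (-t) * v) t := by
    refine d1.congr_deriv ?_
    ring
  have d2' : HasDerivAt (fun t => ei (-t) * (z t).2)
      (-Complex.I * (ei (-t) * v)
        - ((μ * (1 / ‖ei (-t) * q - ((1 - μ : ℝ) : ℂ)‖ ^ 3) : ℝ) : ℂ) *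
          (ei (-t) * q - ((1 - μ : ℝ) : ℂ))
        - (((1 - μ) * (1 / ‖ei (-t) * q + μ‖ ^ 3) : ℝ) : ℂ) * (ei (-t) * q + μ)) t := by
    refine d2.congr_deriv ?_
    rw [← m1, ← m2]
    push_cast
    ring
  simp only [k1, k2]
  generalize ‖ei (-t) * q + μ‖ = a1 at *
  generalize ‖ei (-t) * q - ((1 - μ : ℝ) : ℂ)‖ = a2 at *
  generalize hxx : ei (-t) * q = x at *
  generalize hyy : ei (-t) * v = w at *
  refine ⟨(re_deriv d1').congr_deriv ?_, (im_deriv d1').congr_deriv ?_,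
    (re_deriv d2').congr_deriv ?_, (im_deriv d2').congr_deriv ?_⟩
  · simp; ring
  · simp; ring
  · simp only [Complex.sub_re, Complex.re_ofReal_mul, Complex.add_re, Complex.ofReal_re]
    simp; ring
  · simp only [Complex.sub_im, Complex.im_ofReal_mul, Complex.add_im, Complex.ofReal_im]
    simp; ring

lemma dist4_le (a b : ℂ × ℂ) :
    dist4 (a.1.re, a.1.im, a.2.re, a.2.im) (b.1.re, b.1.im, b.2.re, b.2.im) ≤ 2 * ‖a - b‖ := by
  rw [dist4]
  apply Real.sqrt_le_iff.2
  refine ⟨by positivity, ?_⟩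
  have h1 : ‖a.1 - b.1‖ ≤ ‖a - b‖ := by rw [← Prod.fst_sub]; exact norm_fst_le _
  have h2 : ‖a.2 - b.2‖ ≤ ‖a - b‖ := by rw [← Prod.snd_sub]; exact norm_snd_le _
  have h1' := pow_le_pow_left₀ (norm_nonneg _) h1 2
  have h2' := pow_le_pow_left₀ (norm_nonneg _) h2 2
  rw [Complex.sq_norm, Complex.normSq_apply] at h1' h2'
  simp at h1' h2' ⊢
  nlinarith [sq_nonneg ‖a - b‖]

lemma KK_per_nat {y : ℂ × ℂ} (h : GoodZ y) (n : ℕ) : KK y (n * tau y) = y := by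
  induction n with
  | zero => simp [KK_zero h]
  | succ k ih =>
    have := KK_per h (k * tau y)
    rw [ih] at this
    have e : ((k + 1 : ℕ) : ℝ) * tau y = k * tau y + 2 * π * bb y ^ 3 := by
      push_cast; rw [tau]; ring
    rw [e, this]

def toC (P : ℝ × ℝ × ℝ × ℝ) : ℂ × ℂ := (⟨P.1, P.2.1⟩, ⟨P.2.2.1, P.2.2.2⟩)

lemma main_step {z : ℂ × ℂ} (h : Near (1 / 2000) z) {j : ℕ} (hN : 100000 ≤ 2 ^ j) {μ : ℝ}
    (hμ : 0 < μ) (hκ : C0 * 10 ^ 10 * (2 ^ j : ℕ) ^ 5 * μ ≤ 1) :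
    ∃ (y : ℝ × ℝ × ℝ × ℝ) (T' T : ℝ) (x1 x2 y1 y2 : ℝ → ℝ),
          dist4 y (z.1.re, z.1.im, z.2.re, z.2.im) ≤ 100 * (1 / (2 ^ j : ℕ)) ∧
          0 < T' ∧ T' < T ∧ 1 < T ∧
          IsRCP3BPSol μ (Set.Icc 0 T) x1 x2 y1 y2 ∧
          (x1 0, x2 0, y1 0, y2 0) = y ∧
          dist4 (x1 T, x2 T, y1 T, y2 T) (z.1.re, z.1.im, z.2.re, z.2.im)
            ≤ 100 * (1 / (2 ^ j : ℕ)) ∧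
          norm2 (x1 T' - (1 - μ)) (x2 T') ≤ 100 * (1 / (2 ^ j : ℕ)) + μ := by
  obtain ⟨y, p, T', hy, hp, hyz, hfar, hT0, hT1, hT2⟩ := kepler_summary h hN
  have gy := (hy.mono (by norm_num : (1:ℝ) / 1000 ≤ 1 / 500)).good
  set N := 2 ^ j
  have hNr : (100000 : ℝ) ≤ N := by exact_mod_cast hN
  have hNp : (0 : ℝ) < N := by linarith
  obtain ⟨w, hw0, hw⟩ := perturbed hy hN hμ hκ hfar
  have hτ := tau_bounds gy
  have hTp : (N : ℝ) * tau y = p * (2 * π) := by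
    rw [← hp, tau]; ring
  have hTi : ei (-(N * tau y)) = 1 := by
    have := ei_int (-p)
    rw [hTp]
    push_cast at this
    rw [← this]; congr 1; ring
  have hpos : 0 < 1 / (N:ℝ) := by positivity
  have hT1' : 1 < N * tau y := by nlinarith
  refine ⟨(y.1.re, y.1.im, y.2.re, y.2.im), T', N * tau y, _, _, _, _, ?_, hT0, hT1, hT1',
    sol_of (fun t ht => (hw t ht).2), ?_, ?_, ?_⟩
  · refine (dist4_le y z).trans ?_
    rw [div_eq_mul_one_div] at hyz
    linarith
  · simp [hw0, ei_zero]
  · simp only [hTi, one_mul]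
    refine (dist4_le (w (N * tau y)) z).trans ?_
    have h1 := (hw (N * tau y) ⟨by linarith, le_refl _⟩).1
    rw [KK_per_nat gy] at h1
    have h2 := norm_add_le (w (N * tau y) - y) (y - z)
    rw [sub_add_sub_cancel] at h2
    rw [← one_div_mul_one_div] at h1
    rw [div_eq_mul_one_div] at hyz
    linarith
  · have h1 := (hw T' ⟨hT0.le, hT1.le⟩).1
    have n1 : ‖(w T').1 - (KK y T').1‖ ≤ 1 / (2000 * N) := by
      rw [← Prod.fst_sub]; exact (norm_fst_le _).trans h1
    have e : (ei (-T') * (w T').1).re - (1 - μ) = (ei (-T') * (w T').1 - ((1 - μ : ℝ) : ℂ)).re := by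
      rw [Complex.sub_re, Complex.ofReal_re]
    have e' : (ei (-T') * (w T').1).im = (ei (-T') * (w T').1 - ((1 - μ : ℝ) : ℂ)).im := by
      rw [Complex.sub_im, Complex.ofReal_im, sub_zero]
    rw [e, e', norm2_eq]
    have e2 : ei (-T') * (w T').1 - ((1 - μ : ℝ) : ℂ) = ei (-T') * ((w T').1 - (KK y T').1)
        + (ei (-T') * (KK y T').1 - 1) + (μ : ℂ) := by push_cast; ring
    rw [e2]
    refine (norm_add₃_le).trans ?_
    rw [norm_mul, ei_norm, one_mul, Complex.norm_real, Real.norm_eq_abs, abs_of_pos hμ]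
    rw [← one_div_mul_one_div] at n1
    rw [div_eq_mul_one_div] at hT2
    linarith

lemma toC_cont : Continuous toC := by
  have e : toC = fun P => (((P.1 : ℝ) : ℂ) + ((P.2.1 : ℝ) : ℂ) * Complex.I,
      ((P.2.2.1 : ℝ) : ℂ) + ((P.2.2.2 : ℝ) : ℂ) * Complex.I) := by
    funext P
    simp [toC, Complex.mk_eq_add_mul_I]
  rw [e]
  fun_prop

lemma choose_j : ∃ μ₀ : ℝ, 0 < μ₀ ∧ ∀ μ ∈ Ioo 0 μ₀, ∃ j : ℕ, 100000 ≤ 2 ^ j ∧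
    C0 * 10 ^ 10 * (2 ^ j : ℕ) ^ 5 * μ ≤ 1 ∧ 1 / ((2 ^ j : ℕ) : ℝ) ≤ 2 * μ ^ ((1 : ℝ) / 20)
    ∧ μ ≤ μ ^ ((1 : ℝ) / 20) := by
  have hC : 1 ≤ C0 * 10 ^ 10 := by
    have h1 : 1 ≤ exp ((256 : NNReal) * 10) := Real.one_le_exp (by positivity)
    rw [C0]; nlinarith
  set D := C0 * 10 ^ 10
  have hD : 0 < D := by linarith
  refine ⟨(1 / (1000000 * D)) ^ 20, by positivity, fun μ hμ => ?_⟩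
  obtain ⟨hμ0, hμ1⟩ := hμ
  set δ := μ ^ ((1 : ℝ) / 20) with hδ
  have hδ0 : 0 < δ := by positivity
  have hδμ : δ ^ 20 = μ := by
    rw [hδ, ← Real.rpow_natCast, ← Real.rpow_mul hμ0.le]; norm_num
  have hδ1 : δ < 1 / (1000000 * D) := by
    rw [← hδμ] at hμ1
    exact lt_of_pow_lt_pow_left₀ 20 (by positivity) hμ1
  rw [lt_div_iff₀ (by positivity)] at hδ1
  have hδ2 : δ * 1000000 < 1 := by nlinarith
  have hδ3 : D * δ ≤ 1 := by nlinarith [mul_pos hδ0 hD]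
  have hδle : δ ≤ 1 := by linarith
  have hx : 1 ≤ 1 / δ := by rw [le_div_iff₀ hδ0]; linarith
  obtain ⟨j, hj1, hj2⟩ := exists_nat_pow_near hx (by norm_num : (1:ℝ) < 2)
  have hj3 : (2:ℝ) ^ j * δ ≤ 1 := by rwa [le_div_iff₀ hδ0] at hj1
  have hj4 : 1 < (2:ℝ) ^ (j + 1) * δ := by rwa [div_lt_iff₀ hδ0] at hj2
  rw [pow_succ] at hj4
  have hp : (0:ℝ) < 2 ^ j := by positivity
  refine ⟨j, ?_, ?_, ?_, ?_⟩
  · have : (100000 : ℝ) ≤ 2 ^ j := by nlinarith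
    exact_mod_cast this
  · push_cast
    have e : D * (2 ^ j) ^ 5 * μ = (D * δ) * (2 ^ j * δ) ^ 5 * δ ^ 14 := by rw [← hδμ]; ring
    rw [e]
    have a1 : (2 ^ j * δ) ^ 5 ≤ 1 := pow_le_one₀ (by positivity) hj3
    have a2 : δ ^ 14 ≤ 1 := pow_le_one₀ hδ0.le hδle
    have a3 : (D * δ) * (2 ^ j * δ) ^ 5 ≤ 1 := mul_le_one₀ hδ3 (by positivity) a1
    exact mul_le_one₀ a3 (by positivity) a2
  · push_cast
    rw [div_le_iff₀ hp]
    linarith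
  · rw [← hδμ]
    exact pow_le_of_le_one hδ0.le hδle (by norm_num)

end RC

theorem approximately_nonwandering :
    ∃ (U : Set (ℝ × ℝ × ℝ × ℝ)) (C μ₀ : ℝ),
      IsOpen U ∧ U.Nonempty ∧ 0 < C ∧ 0 < μ₀ ∧
      ∀ μ ∈ Set.Ioo (0 : ℝ) μ₀, ∀ z ∈ U,
        ∃ (y : ℝ × ℝ × ℝ × ℝ) (T' T : ℝ) (x1 x2 y1 y2 : ℝ → ℝ),
          dist4 y z ≤ C * μ ^ ((1 : ℝ) / 20) ∧
          0 < T' ∧ T' < T ∧ 1 < T ∧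
          IsRCP3BPSol μ (Set.Icc 0 T) x1 x2 y1 y2 ∧
          (x1 0, x2 0, y1 0, y2 0) = y ∧
          dist4 (x1 T, x2 T, y1 T, y2 T) z ≤ C * μ ^ ((1 : ℝ) / 20) ∧
          norm2 (x1 T' - (1 - μ)) (x2 T') ≤ C * μ ^ ((1 : ℝ) / 20) := by
  obtain ⟨μ₀, hμ₀, hch⟩ := RC.choose_j
  refine ⟨{P | |RC.rr (RC.toC P) - 1 / 2| < 1 / 2000 ∧ |RC.ss (RC.toC P)| < 1 / 2000 ∧
    |RC.vv (RC.toC P) - 3| < 1 / 2000}, 201, μ₀, ?_, ?_, by norm_num, hμ₀, ?_⟩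
  · have hc := RC.toC_cont
    have h1 : Continuous fun P => RC.rr (RC.toC P) := by exact hc.fst.norm
    have h2 : Continuous fun P => RC.ss (RC.toC P) := by
      exact ((Complex.continuous_re.comp hc.fst).mul (Complex.continuous_re.comp hc.snd)).add
        ((Complex.continuous_im.comp hc.fst).mul (Complex.continuous_im.comp hc.snd))
    have h3 : Continuous fun P => RC.vv (RC.toC P) := by exact hc.snd.norm.pow 2
    exact (isOpen_lt (h1.sub continuous_const).abs continuous_const).inter
      ((isOpen_lt h2.abs continuous_const).inter
        (isOpen_lt (h3.sub continuous_const).abs continuous_const))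
  · refine ⟨(1 / 2, 0, 0, √3), ?_⟩
    have e1 : RC.rr (RC.toC (1 / 2, 0, 0, √3)) = 1 / 2 := by
      rw [RC.rr, RC.toC, Complex.norm_eq_sqrt_sq_add_sq]
      norm_num
    have e2 : RC.ss (RC.toC (1 / 2, 0, 0, √3)) = 0 := by
      simp [RC.ss, RC.toC]
    have e3 : RC.vv (RC.toC (1 / 2, 0, 0, √3)) = 3 := by
      rw [RC.vv, RC.toC, Complex.sq_norm, Complex.normSq_apply]
      norm_num
    simp only [Set.mem_ofPred_eq, e1, e2, e3]
    norm_num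
  · rintro μ hμ z ⟨h1, h2, h3⟩
    obtain ⟨j, hj, hκ, hN, hle⟩ := hch μ hμ
    obtain ⟨y, T', T, x1, x2, y1, y2, g1, g2, g3, g4, g5, g6, g7, g8⟩ :=
      RC.main_step (z := RC.toC z) ⟨h1.le, h2.le, h3.le⟩ hj hμ.1 hκ
    have hδ : 0 < μ ^ ((1 : ℝ) / 20) := Real.rpow_pos_of_pos hμ.1 _
    refine ⟨y, T', T, x1, x2, y1, y2, ?_, g2, g3, g4, g5, g6, ?_, ?_⟩
    · refine g1.trans ?_
      linarith
    · refine g7.trans ?_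
      linarith
    · linarith
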